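/- arXiv:1610.04353 — 3 statements merged into one kernel-verified Lean document; each statement's English description precedes it below -/
import Mathlib

section
/- Let n, m be positive integers and λ = (λ_1,…,λ_n) ∈ ℤ_{≥0}^n with λ_1+⋯+λ_n = m+1. Then the localization (R_m/J_m(x_1⋯x_n))_{𝔭_λ} has finite length as a module over itself, and this length (the multiplicity of J_m(x_1⋯x_n) along 𝔭_λ) equals (m+1)!/(λ_1!·λ_2!⋯λ_n!). -/
open MvPolynomial

set_option synthInstance.maxHeartbeats 1000000
set_option maxHeartbeats 1000000

universe u

theorem exists_universal_splitting (N : ℕ) : ∀ (A : Type u) [CommRing A] [Nontrivial A]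
    {ι : Type} [Fintype ι] [DecidableEq ι] (f : ι → Polynomial A), (∀ i, (f i).Monic) →
    ∑ i, (f i).natDegree = N →
    ∃ (C : Type u) (_ : CommRing C) (_ : Algebra A C) (r : ι → Multiset C),
      Module.Free A C ∧ Module.Finite A C ∧
      Module.finrank A C = ∏ i, (f i).natDegree.factorial ∧
      (∀ i, (f i).map (algebraMap A C) =
        ((r i).map fun a => Polynomial.X - Polynomial.C a).prod) ∧
      Algebra.adjoin A {c | ∃ i, c ∈ r i} = ⊤ ∧
      ∀ (D : Type u) [CommRing D] [Nontrivial D] (g : A →+* D) (s : ι → Multiset D),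
        (∀ i, (f i).map g = ((s i).map fun a => Polynomial.X - Polynomial.C a).prod) →
        ∃ h : C →+* D, h.comp (algebraMap A C) = g ∧ ∀ i, (r i).map h = s i := by
  induction N with
  | zero =>
    intro A _ _ ι _ _ f hf hN
    have hd : ∀ i, (f i).natDegree = 0 := by simpa using hN
    have h1 : ∀ i, f i = 1 := fun i => (hf i).natDegree_eq_zero.mp (hd i)
    refine ⟨A, inferInstance, inferInstance, fun _ => 0, inferInstance, inferInstance,
      ?_, ?_, ?_, ?_⟩
    · simp [hd]
    · simp [h1]
    · exact eq_top_iff.mpr fun c _ => Subalgebra.algebraMap_mem _ c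
    · intro D _ _ g s hs
      refine ⟨g, by ext; simp, fun i => ?_⟩
      have := congrArg Polynomial.natDegree (hs i)
      rw [Polynomial.natDegree_multiset_prod_X_sub_C_eq_card, h1] at this
      simpa [eq_comm] using this
  | succ N ih =>
    intro A _ _ ι _ _ f hf hN
    obtain ⟨i₀, hi₀⟩ : ∃ i, 0 < (f i).natDegree := by
      by_contra! h
      have : ∑ i, (f i).natDegree = 0 := Finset.sum_eq_zero fun i _ => by simpa using h i
      omega
    have hfree : Module.Free A (AdjoinRoot (f i₀)) := (hf i₀).free_adjoinRoot
    have hfin : Module.Finite A (AdjoinRoot (f i₀)) := (hf i₀).finite_adjoinRoot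
    have hrank : Module.finrank A (AdjoinRoot (f i₀)) = (f i₀).natDegree := by
      rw [(AdjoinRoot.powerBasis' (hf i₀)).finrank]; rfl
    have hnt : Nontrivial (AdjoinRoot (f i₀)) :=
      Module.nontrivial_of_finrank_pos (R := A) (by omega)
    set x := AdjoinRoot.root (f i₀) with hx
    obtain ⟨q, hq⟩ : Polynomial.X - Polynomial.C x ∣ (f i₀).map (AdjoinRoot.of (f i₀)) := by
      rw [Polynomial.dvd_iff_isRoot, Polynomial.IsRoot, Polynomial.eval_map]
      exact AdjoinRoot.eval₂_root _
    have hqm : q.Monic :=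
      (Polynomial.monic_X_sub_C x).of_mul_monic_left (hq ▸ (hf i₀).map _)
    have hqd : (f i₀).natDegree = q.natDegree + 1 := by
      have := congrArg Polynomial.natDegree hq
      rw [(hf i₀).natDegree_map, (Polynomial.monic_X_sub_C x).natDegree_mul hqm,
        Polynomial.natDegree_X_sub_C] at this
      omega
    let f' : ι → Polynomial (AdjoinRoot (f i₀)) :=
      Function.update (fun i => (f i).map (AdjoinRoot.of (f i₀))) i₀ q
    have hf'₀ : f' i₀ = q := by simp [f']
    have hf'₁ : ∀ i, i ≠ i₀ → f' i = (f i).map (AdjoinRoot.of (f i₀)) := fun i hi => by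
      simp [f', hi]
    have hf'm : ∀ i, (f' i).Monic := fun i => by
      by_cases hi : i = i₀
      · subst hi; rwa [hf'₀]
      · rw [hf'₁ i hi]; exact (hf i).map _
    have hdeg : ∀ i, i ≠ i₀ → (f' i).natDegree = (f i).natDegree := fun i hi => by
      rw [hf'₁ i hi, (hf i).natDegree_map]
    have hN' : ∑ i, (f' i).natDegree = N := by
      rw [← Finset.add_sum_erase _ _ (Finset.mem_univ i₀)] at hN ⊢
      rw [Finset.sum_congr rfl fun i hi => hdeg i (Finset.ne_of_mem_erase hi), hf'₀]
      omega
    obtain ⟨C, _, _, r, hC₁, hC₂, hC₃, hC₄, hC₅, hC₆⟩ := ih _ f' hf'm hN'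
    let alg : Algebra A C :=
      ((algebraMap (AdjoinRoot (f i₀)) C).comp (AdjoinRoot.of (f i₀))).toAlgebra
    have tower : IsScalarTower A (AdjoinRoot (f i₀)) C := IsScalarTower.of_algebraMap_eq' rfl
    have halg : algebraMap A C =
      (algebraMap (AdjoinRoot (f i₀)) C).comp (AdjoinRoot.of (f i₀)) := rfl
    let r' : ι → Multiset C :=
      Function.update r i₀ (algebraMap (AdjoinRoot (f i₀)) C x ::ₘ r i₀)
    have hr'₀ : r' i₀ = algebraMap (AdjoinRoot (f i₀)) C x ::ₘ r i₀ := by simp [r']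
    have hr'₁ : ∀ i, i ≠ i₀ → r' i = r i := fun i hi => by simp [r', hi]
    refine ⟨C, inferInstance, alg, r', Module.Free.trans (S := AdjoinRoot (f i₀)),
      Module.Finite.trans (AdjoinRoot (f i₀)) C, ?_, ?_, ?_, ?_⟩
    · rw [← Module.finrank_mul_finrank A (AdjoinRoot (f i₀)) C, hC₃, hrank,
        ← Finset.mul_prod_erase _ _ (Finset.mem_univ i₀),
        ← Finset.mul_prod_erase _ (fun i => (f i).natDegree.factorial) (Finset.mem_univ i₀),
        Finset.prod_congr rfl fun i hi => by rw [hdeg i (Finset.ne_of_mem_erase hi)],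
        hf'₀, hqd, Nat.factorial_succ, mul_assoc]
    · intro i
      rw [halg, ← Polynomial.map_map]
      by_cases hi : i = i₀
      · subst hi
        rw [hq, hr'₀, Multiset.map_cons, Multiset.prod_cons, ← hC₄, hf'₀]
        simp
      · rw [hr'₁ i hi, ← hC₄, hf'₁ i hi]
    · have hsub : ∀ i, ∀ c ∈ r i, c ∈ r' i := fun i c hc => by
        by_cases hi : i = i₀
        · subst hi; rw [hr'₀]; exact Multiset.mem_cons_of_mem hc
        · rwa [hr'₁ i hi]
      rw [eq_top_iff]
      intro c _
      have hc : c ∈ Algebra.adjoin (AdjoinRoot (f i₀)) {c | ∃ i, c ∈ r i} := by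
        rw [hC₅]; trivial
      induction hc using Algebra.adjoin_induction with
      | mem c hc =>
        obtain ⟨i, hi⟩ := hc
        exact Algebra.subset_adjoin ⟨i, hsub i c hi⟩
      | algebraMap a =>
        obtain ⟨p, rfl⟩ := AdjoinRoot.mk_surjective a
        have : algebraMap (AdjoinRoot (f i₀)) C (AdjoinRoot.mk (f i₀) p) =
            Polynomial.aeval (algebraMap (AdjoinRoot (f i₀)) C x) p := by
          rw [Polynomial.aeval_algebraMap_apply, hx, AdjoinRoot.aeval_eq]
        rw [this]
        refine Algebra.adjoin_mono ?_ (Polynomial.aeval_mem_adjoin_singleton A _)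
        rintro _ rfl
        exact ⟨i₀, by rw [hr'₀]; exact Multiset.mem_cons_self _ _⟩
      | add a b _ _ ha hb => exact add_mem (ha trivial) (hb trivial)
      | mul a b _ _ ha hb => exact mul_mem (ha trivial) (hb trivial)
    · intro D _ _ g s hs
      have hcard : Multiset.card (s i₀) = (f i₀).natDegree := by
        have := congrArg Polynomial.natDegree (hs i₀)
        rwa [Polynomial.natDegree_multiset_prod_X_sub_C_eq_card, (hf i₀).natDegree_map,
          eq_comm] at this
      obtain ⟨a, ha⟩ : ∃ a, a ∈ s i₀ := Multiset.card_pos_iff_exists_mem.mp (by omega)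
      obtain ⟨s₀, hs₀⟩ := Multiset.exists_cons_of_mem ha
      have hroot : (f i₀).eval₂ g a = 0 := by
        rw [← Polynomial.eval_map, hs i₀, hs₀, Multiset.map_cons, Multiset.prod_cons]
        simp
      let g' : AdjoinRoot (f i₀) →+* D := AdjoinRoot.lift g a hroot
      have hg' : g'.comp (AdjoinRoot.of (f i₀)) = g := AdjoinRoot.lift_comp_of _
      have hg'x : g' x = a := AdjoinRoot.lift_root _
      obtain ⟨h, hh₁, hh₂⟩ := hC₆ D g' (Function.update s i₀ s₀) (fun i => by
        by_cases hi : i = i₀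
        · subst hi
          have h1 := hs i
          rw [← hg', ← Polynomial.map_map, hq, hs₀, Multiset.map_cons, Multiset.prod_cons,
            Polynomial.map_mul] at h1
          simp only [Polynomial.map_sub, Polynomial.map_X, Polynomial.map_C, hg'x] at h1
          simpa [hf'₀] using (Polynomial.monic_X_sub_C a).isRegular.left h1
        · rw [hf'₁ i hi, Polynomial.map_map, hg', hs i]; simp [hi])
      refine ⟨h, by rw [halg, ← RingHom.comp_assoc, hh₁, hg'], fun i => ?_⟩
      by_cases hi : i = i₀
      · subst hi
        rw [hr'₀, Multiset.map_cons, hh₂, hs₀, ← hg'x, ← hh₁]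
        simp
      · rw [hr'₁ i hi, hh₂]; simp [hi]

theorem exists_universal_factorization_X_pow (K : Type u) [Field K] {n : ℕ} (lam : Fin n → ℕ) :
    ∃ (T : Type u) (_ : CommRing T) (_ : Algebra K T) (W : Fin n → Polynomial T),
      Nontrivial T ∧ (∀ i, (W i).Monic) ∧ (∀ i, (W i).natDegree = lam i) ∧
      ∏ i, W i = Polynomial.X ^ (∑ i, lam i) ∧
      Algebra.adjoin K {c | ∃ i, ∃ j < lam i, c = (W i).coeff j} = ⊤ ∧
      ∀ (D : Type u) [CommRing D] (g : K →+* D) (V : Fin n → Polynomial D),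
        (∀ i, (V i).Monic) → (∀ i, (V i).natDegree = lam i) →
        ∏ i, V i = Polynomial.X ^ (∑ i, lam i) →
        ∃ h : T →+* D, h.comp (algebraMap K T) = g ∧ ∀ i, (W i).map h = V i := by
  let A := MvPolynomial (Σ i, Fin (lam i)) K
  let W₀ : Fin n → Polynomial A := fun i =>
    Polynomial.X ^ lam i + ∑ j : Fin (lam i), Polynomial.C (X ⟨i, j⟩) * Polynomial.X ^ (j : ℕ)
  let I : Ideal A :=
    Ideal.span {q | ∃ d, q = (∏ i, W₀ i - Polynomial.X ^ (∑ i, lam i)).coeff d}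
  let π : A →ₐ[K] A ⧸ I := Ideal.Quotient.mkₐ K I
  have hdeg : ∀ i, (∑ j : Fin (lam i), Polynomial.C (X ⟨i, j⟩ : A) *
      Polynomial.X ^ (j : ℕ)).degree < (lam i : WithBot ℕ) := fun i => Polynomial.degree_sum_fin_lt _
  have hW₀m : ∀ i, (W₀ i).Monic := fun i => Polynomial.monic_X_pow_add (hdeg i)
  have hW₀d : ∀ i, (W₀ i).natDegree = lam i := fun i => by
    rw [Polynomial.natDegree_add_eq_left_of_degree_lt, Polynomial.natDegree_X_pow]
    simpa using hdeg i
  have hW₀c : ∀ i (j : Fin (lam i)), (W₀ i).coeff j = X ⟨i, j⟩ := fun i j => by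
    simp only [W₀, Polynomial.coeff_add, Polynomial.coeff_X_pow, Polynomial.finsetSum_coeff,
      Polynomial.coeff_C_mul]
    rw [if_neg j.2.ne, zero_add, Finset.sum_eq_single j]
    · simp
    · intro b _ hb
      rw [if_neg (fun h => hb (Fin.ext h.symm)), mul_zero]
    · simp
  have huniv : ∀ (D : Type u) [CommRing D] (g : K →+* D) (V : Fin n → Polynomial D),
        (∀ i, (V i).Monic) → (∀ i, (V i).natDegree = lam i) →
        ∏ i, V i = Polynomial.X ^ (∑ i, lam i) →
        ∃ h : A ⧸ I →+* D, h.comp (algebraMap K (A ⧸ I)) = g ∧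
          ∀ i, ((W₀ i).map π.toRingHom).map h = V i := by
    intro D _ g V hVm hVd hV
    let h₀ : A →+* D := eval₂Hom g fun p => (V p.1).coeff p.2
    have hC : ∀ a, h₀ (C a) = g a := fun a => eval₂Hom_C _ _ a
    have hX : ∀ i (j : Fin (lam i)), h₀ (X ⟨i, j⟩) = (V i).coeff j := fun i j => eval₂Hom_X' _ _ _
    have hh₀ : ∀ i, (W₀ i).map h₀ = V i := fun i => by
      conv_rhs => rw [(hVm i).as_sum, hVd i, ← Fin.sum_univ_eq_sum_range
        (fun j => Polynomial.C ((V i).coeff j) * Polynomial.X ^ j)]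
      simp [W₀, hX, Polynomial.map_sum]
    have hI : ∀ a ∈ I, h₀ a = 0 := by
      intro a ha
      refine (Ideal.span_le (I := RingHom.ker h₀)).mpr ?_ ha
      rintro _ ⟨d, rfl⟩
      change h₀ _ = 0
      rw [← Polynomial.coeff_map, Polynomial.map_sub, Polynomial.map_prod]
      simp [hh₀, hV]
    refine ⟨Ideal.Quotient.lift I h₀ hI, ?_, fun i => ?_⟩
    · ext a
      change h₀ (C a) = g a
      exact hC a
    · rw [Polynomial.map_map, ← hh₀ i]
      rfl
  obtain ⟨h₁, -, -⟩ := huniv K (RingHom.id K) (fun i => Polynomial.X ^ lam i)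
    (fun i => Polynomial.monic_X_pow _) (fun i => Polynomial.natDegree_X_pow _)
    (Finset.prod_pow_eq_pow_sum _ _ _)
  have hnt : Nontrivial (A ⧸ I) := h₁.domain_nontrivial
  refine ⟨A ⧸ I, inferInstance, inferInstance, fun i => (W₀ i).map π.toRingHom, hnt,
    fun i => (hW₀m i).map _, fun i => by rw [(hW₀m i).natDegree_map, hW₀d], ?_, ?_, huniv⟩
  · rw [← Polynomial.map_prod, ← sub_eq_zero]
    ext d
    rw [show (Polynomial.X : Polynomial (A ⧸ I)) ^ (∑ i, lam i) =
      (Polynomial.X ^ (∑ i, lam i)).map π.toRingHom by simp, ← Polynomial.map_sub,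
      Polynomial.coeff_map, Polynomial.coeff_zero]
    exact Ideal.Quotient.eq_zero_iff_mem.mpr (Ideal.subset_span ⟨d, rfl⟩)
  · rw [eq_top_iff]
    rintro t -
    obtain ⟨p, rfl⟩ := Ideal.Quotient.mk_surjective t
    change π p ∈ _
    induction p using MvPolynomial.induction_on with
    | C a => exact Subalgebra.algebraMap_mem _ a
    | add p q hp hq => rw [map_add]; exact add_mem hp hq
    | mul_X p x hp =>
      rw [map_mul]
      refine mul_mem hp (Algebra.subset_adjoin ⟨x.1, x.2, x.2.2, ?_⟩)
      rw [Polynomial.coeff_map, hW₀c]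
      rfl

theorem exists_multiset_sum_eq {α ι : Type*} [DecidableEq ι] (s : Finset ι) (lam : ι → ℕ) :
    ∀ (t : Multiset α), Multiset.card t = ∑ i ∈ s, lam i →
      ∃ r : ι → Multiset α, (∀ i ∈ s, Multiset.card (r i) = lam i) ∧ ∑ i ∈ s, r i = t := by
  induction s using Finset.induction_on with
  | empty => intro t ht; exact ⟨0, by simp, by simpa [eq_comm] using ht⟩
  | insert a s ha ih =>
    intro t ht
    rw [Finset.sum_insert ha] at ht
    obtain ⟨t₁, hm⟩ : ∃ t₁, t₁ ∈ Multiset.powersetCard (lam a) t := by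
      rw [← Multiset.card_pos_iff_exists_mem, Multiset.card_powersetCard]
      exact Nat.choose_pos (by omega)
    obtain ⟨ht₁, hc⟩ := Multiset.mem_powersetCard.mp hm
    obtain ⟨t₂, rfl⟩ := Multiset.le_iff_exists_add.mp ht₁
    rw [Multiset.card_add] at ht
    obtain ⟨r, hr₁, hr₂⟩ := ih t₂ (by omega)
    have hne : ∀ i ∈ s, i ≠ a := fun i hi h => ha (h ▸ hi)
    refine ⟨Function.update r a t₁, fun i hi => ?_, ?_⟩
    · rcases Finset.mem_insert.mp hi with rfl | hi
      · simpa using hc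
      · simpa [hne i hi] using hr₁ i hi
    · rw [Finset.sum_insert ha, ← hr₂]
      congr 1
      · simp
      · exact Finset.sum_congr rfl fun i hi => by simp [hne i hi]

theorem finrank_universal_factorization_X_pow {K : Type u} [Field K] {n : ℕ} {lam : Fin n → ℕ}
    {T : Type u} [CommRing T] [Algebra K T] [Nontrivial T] (W : Fin n → Polynomial T)
    (hWm : ∀ i, (W i).Monic) (hWd : ∀ i, (W i).natDegree = lam i)
    (hW : ∏ i, W i = Polynomial.X ^ (∑ i, lam i))
    (hadj : Algebra.adjoin K {c | ∃ i, ∃ j < lam i, c = (W i).coeff j} = ⊤)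
    (huniv : ∀ (D : Type u) [CommRing D] (g : K →+* D) (V : Fin n → Polynomial D),
        (∀ i, (V i).Monic) → (∀ i, (V i).natDegree = lam i) →
        ∏ i, V i = Polynomial.X ^ (∑ i, lam i) →
        ∃ h : T →+* D, h.comp (algebraMap K T) = g ∧ ∀ i, (W i).map h = V i) :
    Module.Finite K T ∧
      Module.finrank K T * ∏ i, (lam i).factorial = (∑ i, lam i).factorial := by
  obtain ⟨S, _, _, r, hS₁, hS₂, hS₃, hS₄, hS₅, hS₆⟩ := exists_universal_splitting _ K
    (fun _ : Unit => (Polynomial.X : Polynomial K) ^ (∑ i, lam i))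
    (fun _ => Polynomial.monic_X_pow _) rfl
  obtain ⟨T', _, _, s, hT₁, hT₂, hT₃, hT₄, hT₅, hT₆⟩ :=
    exists_universal_splitting _ T W hWm rfl
  have hSr : Module.finrank K S = (∑ i, lam i).factorial := by simpa using hS₃
  have hSn : Nontrivial S := Module.nontrivial_of_finrank_pos (R := K) (by
    rw [hSr]; exact Nat.factorial_pos _)
  have hT'n : Nontrivial T' := Module.nontrivial_of_finrank_pos (R := T) (by
    rw [hT₃]; exact Finset.prod_pos fun i _ => Nat.factorial_pos _)
  let alg : Algebra K T' := ((algebraMap T T').comp (algebraMap K T)).toAlgebra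
  have tower : IsScalarTower K T T' := IsScalarTower.of_algebraMap_eq' rfl
  have hsum : ∀ {R : Type u} [CommRing R] (q : Fin n → Multiset R),
      ((∑ i, q i).map fun a => Polynomial.X - Polynomial.C a).prod =
        ∏ i, ((q i).map fun a => Polynomial.X - Polynomial.C a).prod := by
    intro R _ q
    rw [← Multiset.coe_mapAddMonoidHom, map_sum, Multiset.prod_sum]
  obtain ⟨φ, hφ, hφr⟩ := hS₆ T' (algebraMap K T') (fun _ => ∑ i, s i) (fun _ => by
    rw [hsum, ← Finset.prod_congr rfl fun i _ => hT₄ i, ← Polynomial.map_prod, hW]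
    simp)
  have hcard : Multiset.card (r ()) = ∑ i, lam i := by
    have := congrArg Polynomial.natDegree (hS₄ ())
    rw [Polynomial.natDegree_multiset_prod_X_sub_C_eq_card] at this
    simpa [eq_comm] using this
  obtain ⟨q, hq₁, hq₂⟩ := exists_multiset_sum_eq Finset.univ lam (r ()) hcard
  obtain ⟨g, hg, hgW⟩ := huniv S (algebraMap K S)
    (fun i => ((q i).map fun a => Polynomial.X - Polynomial.C a).prod)
    (fun i => Polynomial.monic_multiset_prod_of_monic _ _ fun a _ => Polynomial.monic_X_sub_C a)
    (fun i => by
      rw [Polynomial.natDegree_multiset_prod_X_sub_C_eq_card, hq₁ i (Finset.mem_univ i)])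
    (by rw [← hsum, hq₂, ← hS₄]; simp)
  obtain ⟨ψ, hψ, hψs⟩ := hT₆ S g q hgW
  let φ' : S →ₐ[K] T' := { φ with commutes' := fun a => RingHom.congr_fun hφ a }
  let ψ' : T' →ₐ[K] S := { ψ with
    commutes' := fun a => (RingHom.congr_fun hψ (algebraMap K T a)).trans (RingHom.congr_fun hg a) }
  have hφ' : Function.Surjective φ' := by
    rw [← AlgHom.range_eq_top, eq_top_iff]
    have hroots : ∀ i, ∀ c ∈ s i, c ∈ φ'.range := by
      intro i c hc
      have : c ∈ (r ()).map φ := by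
        rw [hφr, Multiset.mem_sum]
        exact ⟨i, Finset.mem_univ i, hc⟩
      obtain ⟨a, -, ha⟩ := Multiset.mem_map.mp this
      exact ⟨a, ha⟩
    have hprod : ∀ (t : Multiset T'), (∀ c ∈ t, c ∈ φ'.range) → ∀ j,
        (t.map fun a => Polynomial.X - Polynomial.C a).prod.coeff j ∈ φ'.range := by
      intro t ht j
      obtain ⟨t', rfl⟩ : ∃ t' : Multiset φ'.range, t = t'.map Subtype.val :=
        ⟨t.attach.map fun c => ⟨c.1, ht _ c.2⟩, by simp⟩
      have : ((t'.map Subtype.val).map fun a : T' => Polynomial.X - Polynomial.C a).prod =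
          ((t'.map fun a => Polynomial.X - Polynomial.C a).prod).map φ'.range.val.toRingHom := by
        rw [Polynomial.map_multiset_prod, Multiset.map_map, Multiset.map_map]
        congr 1
        refine Multiset.map_congr rfl fun a _ => ?_
        simp
      rw [this, Polynomial.coeff_map]
      exact Subtype.property _
    have hT : ∀ t : T, algebraMap T T' t ∈ φ'.range := by
      intro t
      have ht : t ∈ Algebra.adjoin K {c | ∃ i, ∃ j < lam i, c = (W i).coeff j} := by
        rw [hadj]; trivial
      induction ht using Algebra.adjoin_induction with
      | mem c hc =>
        obtain ⟨i, j, -, rfl⟩ := hc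
        rw [← Polynomial.coeff_map, hT₄]
        exact hprod _ (hroots i) j
      | algebraMap a =>
        rw [← IsScalarTower.algebraMap_apply]
        exact Subalgebra.algebraMap_mem _ a
      | add a b _ _ ha hb => rw [map_add]; exact add_mem ha hb
      | mul a b _ _ ha hb => rw [map_mul]; exact mul_mem ha hb
    rintro c -
    have hc : c ∈ Algebra.adjoin T {c | ∃ i, c ∈ s i} := by rw [hT₅]; trivial
    induction hc using Algebra.adjoin_induction with
    | mem c hc => obtain ⟨i, hi⟩ := hc; exact hroots i c hi
    | algebraMap a => exact hT a
    | add a b _ _ ha hb => exact add_mem ha hb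
    | mul a b _ _ ha hb => exact mul_mem ha hb
  have hψ' : Function.Surjective ψ' := by
    rw [← AlgHom.range_eq_top, eq_top_iff, ← hS₅, Algebra.adjoin_le_iff]
    rintro c ⟨⟨⟩, hc⟩
    rw [← hq₂, Multiset.mem_sum] at hc
    obtain ⟨i, -, hi⟩ := hc
    rw [← hψs i] at hi
    obtain ⟨a, -, ha⟩ := Multiset.mem_map.mp hi
    exact ⟨a, ha⟩
  have hT'fin : Module.Finite K T' := Module.Finite.of_surjective φ'.toLinearMap hφ'
  have hinj : Function.Injective (algebraMap T T') := FaithfulSMul.algebraMap_injective T T'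
  have hTfin : Module.Finite K T :=
    Module.Finite.of_injective (IsScalarTower.toAlgHom K T T').toLinearMap hinj
  refine ⟨hTfin, ?_⟩
  have h1 := LinearMap.finrank_le_finrank_of_surjective (f := φ'.toLinearMap) hφ'
  have h2 := LinearMap.finrank_le_finrank_of_surjective (f := ψ'.toLinearMap) hψ'
  rw [← hSr, ← le_antisymm h1 h2, ← Module.finrank_mul_finrank K T T', hT₃]
  simp only [hWd]

theorem Polynomial.Monic.eq_X_pow_of_dvd_X_pow {R : Type*} [CommRing R] [IsDomain R]
    {p : Polynomial R} (hp : p.Monic) {N : ℕ} (h : p ∣ Polynomial.X ^ N) :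
    p = Polynomial.X ^ p.natDegree := by
  obtain ⟨i, -, hi⟩ := (dvd_prime_pow Polynomial.prime_X N).mp h
  have := Polynomial.eq_of_monic_of_associated hp (Polynomial.monic_X_pow i) hi
  rw [this, Polynomial.natDegree_X_pow]

theorem Polynomial.isNilpotent_coeff_of_prod_eq_X_pow {R ι : Type*} [CommRing R] [Fintype ι]
    {W : ι → Polynomial R} (hW : ∀ i, (W i).Monic) {N : ℕ} (h : ∏ i, W i = Polynomial.X ^ N)
    (i : ι) {j : ℕ} (hj : j < (W i).natDegree) : IsNilpotent ((W i).coeff j) := by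
  rw [nilpotent_iff_mem_prime]
  intro Q hQ
  have h1 : (W i).map (Ideal.Quotient.mk Q) ∣ Polynomial.X ^ N := by
    have := Polynomial.map_dvd (Ideal.Quotient.mk Q) (Finset.dvd_prod_of_mem W (Finset.mem_univ i))
    rwa [h, Polynomial.map_pow, Polynomial.map_X] at this
  have h2 := congrArg (fun p => p.coeff j) (((hW i).map _).eq_X_pow_of_dvd_X_pow h1)
  rw [(hW i).natDegree_map] at h2
  simp only [Polynomial.coeff_map, Polynomial.coeff_X_pow, if_neg hj.ne] at h2
  exact Ideal.Quotient.eq_zero_iff_mem.mp h2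

theorem exists_universal_factorization_X_pow_length (K : Type u) [Field K] {n : ℕ}
    (lam : Fin n → ℕ) :
    ∃ (T : Type u) (_ : CommRing T) (_ : Algebra K T) (W : Fin n → Polynomial T),
      (∀ i, (W i).Monic) ∧ (∀ i, (W i).natDegree = lam i) ∧
      ∏ i, W i = Polynomial.X ^ (∑ i, lam i) ∧
      (∃ M, Ideal.span {c | ∃ i, ∃ j < lam i, c = (W i).coeff j} ^ M = ⊥) ∧
      (∀ t, ∃ a, t - algebraMap K T a ∈ Ideal.span {c | ∃ i, ∃ j < lam i, c = (W i).coeff j}) ∧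
      Module.length T T = ((∑ i, lam i).factorial / ∏ i, (lam i).factorial : ℕ) ∧
      ∀ (D : Type u) [CommRing D] (g : K →+* D) (V : Fin n → Polynomial D),
        (∀ i, (V i).Monic) → (∀ i, (V i).natDegree = lam i) →
        ∏ i, V i = Polynomial.X ^ (∑ i, lam i) →
        ∃ h : T →+* D, h.comp (algebraMap K T) = g ∧ ∀ i, (W i).map h = V i := by
  obtain ⟨T, _, _, W, hnt, hWm, hWd, hW, hadj, huniv⟩ :=
    exists_universal_factorization_X_pow K lam
  obtain ⟨hfin, hrank⟩ := finrank_universal_factorization_X_pow W hWm hWd hW hadj huniv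
  set I : Ideal T := Ideal.span {c | ∃ i, ∃ j < lam i, c = (W i).coeff j} with hI
  have hInil : I ≤ nilradical T := by
    rw [hI, Ideal.span_le]
    rintro _ ⟨i, j, hj, rfl⟩
    exact Polynomial.isNilpotent_coeff_of_prod_eq_X_pow hWm hW i (by rwa [hWd])
  have hnoeth : IsNoetherianRing T := IsNoetherianRing.of_finite K T
  obtain ⟨M, hM⟩ := IsNoetherianRing.isNilpotent_nilradical T
  have hmod : ∀ t, ∃ a, t - algebraMap K T a ∈ I := by
    intro t
    have ht : t ∈ Algebra.adjoin K {c | ∃ i, ∃ j < lam i, c = (W i).coeff j} := by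
      rw [hadj]; trivial
    induction ht using Algebra.adjoin_induction with
    | mem c hc => exact ⟨0, by simpa using Ideal.subset_span hc⟩
    | algebraMap a => exact ⟨a, by simp⟩
    | add x y _ _ hx hy =>
      obtain ⟨a, ha⟩ := hx
      obtain ⟨b, hb⟩ := hy
      refine ⟨a + b, ?_⟩
      rw [map_add, add_sub_add_comm]
      exact add_mem ha hb
    | mul x y _ _ hx hy =>
      obtain ⟨a, ha⟩ := hx
      obtain ⟨b, hb⟩ := hy
      refine ⟨a * b, ?_⟩
      have : x * y - algebraMap K T (a * b) =
          (x - algebraMap K T a) * y + algebraMap K T a * (y - algebraMap K T b) := by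
        rw [map_mul]; ring
      rw [this]
      exact add_mem (I.mul_mem_right _ ha) (I.mul_mem_left _ hb)
  have hunit : ∀ t, t ∉ I → IsUnit t := by
    intro t ht
    obtain ⟨a, ha⟩ := hmod t
    have ha0 : a ≠ 0 := by rintro rfl; exact ht (by simpa using ha)
    have := IsNilpotent.isUnit_add_left_of_commute (hInil ha)
      ((IsUnit.mk0 a ha0).map (algebraMap K T)) (Commute.all _ _)
    simpa using this
  have hItop : I ≠ ⊤ := fun h => by
    have h1 : (1 : T) ∈ nilradical T := hInil (h ▸ trivial)
    exact not_isNilpotent_one h1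
  have hlocal : IsLocalRing T := IsLocalRing.of_nonunits_add fun a b ha hb => by
    have h1 : ∀ c ∈ nonunits T, c ∈ I := fun c hc => by_contra fun h => hc (hunit c h)
    exact fun h => hItop (Ideal.eq_top_of_isUnit_mem _ (add_mem (h1 a ha) (h1 b hb)) h)
  have hImax : I ≤ IsLocalRing.maximalIdeal T := IsLocalRing.le_maximalIdeal hItop
  refine ⟨T, inferInstance, inferInstance, W, hWm, hWd, hW,
    ⟨M, eq_bot_iff.mpr ((Ideal.pow_right_mono hInil M).trans hM.le)⟩, hmod, ?_, huniv⟩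
  have hsurj : Function.Surjective
      (algebraMap (IsLocalRing.ResidueField K) (IsLocalRing.ResidueField T)) := by
    intro y
    obtain ⟨t, rfl⟩ := IsLocalRing.residue_surjective y
    obtain ⟨a, ha⟩ := hmod t
    refine ⟨IsLocalRing.residue K a, ?_⟩
    change IsLocalRing.residue T (algebraMap K T a) = _
    rw [eq_comm, ← sub_eq_zero, ← map_sub]
    exact Ideal.Quotient.eq_zero_iff_mem.mpr (hImax ha)
  have h1 := IsLocalRing.length_restrictScalars K T T
  rw [Module.length_eq_of_surjective hsurj, Module.length_eq_one (IsLocalRing.ResidueField T), mul_one,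
    Module.length_eq_finrank] at h1
  rw [← h1, ← hrank, Nat.mul_div_cancel _ (Finset.prod_pos fun i _ => Nat.factorial_pos _)]

theorem IsAdicComplete.of_pow_eq_bot {A : Type*} [CommRing A] {I : Ideal A} {M : ℕ}
    (h : I ^ M = ⊥) : IsAdicComplete I A where
  haus' x hx := by simpa [h, SModEq.bot] using hx M
  prec' f hf := by
    refine ⟨f M, fun N => ?_⟩
    rcases le_total N M with hN | hN
    · exact hf hN
    · have h1 : f M ≡ f N [SMOD (I ^ M • ⊤ : Submodule A A)] := hf hN
      rw [h, Submodule.bot_smul, SModEq.bot] at h1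
      rw [h1]

theorem RingHom.surjective_of_le_map_comap {A C : Type*} [CommRing A] [CommRing C] (f : A →+* C)
    (I : Ideal C) {M : ℕ} (hM : I ^ M = ⊥) (hI : I ≤ (I.comap f).map f)
    (h : ∀ c, ∃ a, c - f a ∈ I) : Function.Surjective f := by
  have key : ∀ N, ∀ c ∈ I ^ N, ∃ a, c - f a ∈ I ^ (N + 1) := by
    intro N c hc
    have hc' : c ∈ ((I.comap f) ^ N).map f := by
      rw [Ideal.map_pow]; exact Ideal.pow_right_mono hI N hc
    induction hc' using Submodule.span_induction with
    | zero => exact ⟨0, by simp⟩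
    | mem c hc' => obtain ⟨a, -, rfl⟩ := hc'; exact ⟨a, by simp⟩
    | add x y hx hy ihx ihy =>
      have hle : ((I.comap f) ^ N).map f ≤ I ^ N := by
        rw [Ideal.map_pow]; exact Ideal.pow_right_mono Ideal.map_comap_le N
      obtain ⟨a, ha⟩ := ihx (hle hx)
      obtain ⟨b, hb⟩ := ihy (hle hy)
      exact ⟨a + b, by rw [map_add, add_sub_add_comm]; exact add_mem ha hb⟩
    | smul r x hx ihx =>
      have hle : ((I.comap f) ^ N).map f ≤ I ^ N := by
        rw [Ideal.map_pow]; exact Ideal.pow_right_mono Ideal.map_comap_le N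
      obtain ⟨a, ha⟩ := ihx (hle hx)
      obtain ⟨b, hb⟩ := h r
      refine ⟨b * a, ?_⟩
      have : r • x - f (b * a) = (r - f b) * x + f b * (x - f a) := by
        rw [map_mul, smul_eq_mul]; ring
      rw [this, pow_succ']
      refine add_mem (Ideal.mul_mem_mul hb (hle hx)) (Ideal.mul_mem_left _ _ ?_)
      rwa [← pow_succ']
  have key' : ∀ N, ∀ c, ∃ a, c - f a ∈ I ^ N := by
    intro N
    induction N with
    | zero => intro c; exact ⟨0, by simp⟩
    | succ N ih =>
      intro c
      obtain ⟨a, ha⟩ := ih c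
      obtain ⟨b, hb⟩ := key N _ ha
      exact ⟨a + b, by rwa [map_add, ← sub_sub]⟩
  intro c
  obtain ⟨a, ha⟩ := key' M c
  rw [hM, Ideal.mem_bot, sub_eq_zero] at ha
  exact ⟨a, ha.symm⟩

theorem Module.length_self_le_of_surjective {A C : Type*} [CommRing A] [CommRing C] (f : A →+* C)
    (hf : Function.Surjective f) : Module.length C C ≤ Module.length A A := by
  algebraize [f]
  rw [← Module.length_eq_of_surjective (R := C) (M := C) (S := A) hf]
  exact Module.length_le_of_surjective (Algebra.linearMap A C) hf

theorem Polynomial.X_pow_dvd_of_X_pow_dvd_mul {A : Type*} [CommRing A] {p q : Polynomial A}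
    (hq : IsUnit (q.coeff 0)) {N : ℕ} (h : Polynomial.X ^ N ∣ p * q) : Polynomial.X ^ N ∣ p := by
  have hc : IsCoprime (Polynomial.X : Polynomial A) q := by
    obtain ⟨u, hu⟩ := hq.exists_left_inv
    refine ⟨-Polynomial.C u * q.divX, Polynomial.C u, ?_⟩
    have h1 := Polynomial.X_mul_divX_add q
    have h2 : Polynomial.C u * Polynomial.C (q.coeff 0) = 1 := by
      rw [← Polynomial.C_mul, hu, Polynomial.C_1]
    linear_combination h2 - Polynomial.C u * h1
  exact hc.pow_left.dvd_of_dvd_mul_right h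

theorem Polynomial.X_pow_dvd_of_X_pow_dvd_prod {A ι : Type*} [CommRing A] [IsDomain A] [Fintype ι]
    {p : ι → Polynomial A} {l : ι → ℕ} (hp : ∀ i, (p i).coeff (l i) ≠ 0)
    (h : Polynomial.X ^ (∑ i, l i) ∣ ∏ i, p i) (i : ι) : Polynomial.X ^ l i ∣ p i := by
  have hfac : ∀ i, ∃ (μ : ℕ) (q : Polynomial A), p i = Polynomial.X ^ μ * q ∧ q.coeff 0 ≠ 0 := by
    intro i
    have h0 : p i ≠ 0 := fun h0 => hp i (by simp [h0])
    obtain ⟨q, hq₁, hq₂⟩ := Polynomial.exists_eq_pow_rootMultiplicity_mul_and_not_dvd (p i) h0 0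
    rw [Polynomial.C_0, sub_zero] at hq₁ hq₂
    exact ⟨_, q, hq₁, by rwa [Polynomial.X_dvd_iff] at hq₂⟩
  choose μ q hpq hq using hfac
  have hle : ∀ i, μ i ≤ l i := fun i => by
    by_contra! hlt
    exact hp i ((Polynomial.X_pow_dvd_iff.mp ⟨q i, hpq i⟩) _ hlt)
  have hsum : ∑ i, l i ≤ ∑ i, μ i := by
    by_contra! hlt
    have h1 := Polynomial.X_pow_dvd_iff.mp h _ hlt
    rw [Finset.prod_congr rfl fun i _ => hpq i, Finset.prod_mul_distrib,
      Finset.prod_pow_eq_pow_sum, Polynomial.coeff_X_pow_mul', if_pos le_rfl, Nat.sub_self,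
      Polynomial.coeff_zero_prod] at h1
    exact Finset.prod_ne_zero_iff.mpr (fun i _ => hq i) h1
  have heq := (Finset.sum_eq_sum_iff_of_le fun i _ => hle i).mp
    (le_antisymm (Finset.sum_le_sum fun i _ => hle i) hsum) i (Finset.mem_univ i)
  exact ⟨q i, heq ▸ hpq i⟩

theorem IsLocalRing.exists_weierstrass_factorization {B : Type*} [CommRing B] [IsLocalRing B]
    {M : ℕ} (hM : IsLocalRing.maximalIdeal B ^ M = ⊥) (x : Polynomial B) (l : ℕ)
    (hx : ∀ j < l, x.coeff j ∈ IsLocalRing.maximalIdeal B)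
    (hxl : x.coeff l ∉ IsLocalRing.maximalIdeal B) :
    ∃ (f : Polynomial B) (h : PowerSeries B), f.Monic ∧ f.natDegree = l ∧ IsUnit h ∧
      (∀ j < l, f.coeff j ∈ IsLocalRing.maximalIdeal B) ∧ (x : PowerSeries B) = f * h := by
  have := IsAdicComplete.of_pow_eq_bot hM
  have hord : ((x : PowerSeries B).map (IsLocalRing.residue B)).order = l := by
    rw [PowerSeries.order_eq_nat]
    simp only [PowerSeries.coeff_map, Polynomial.coeff_coe, ne_eq, IsLocalRing.residue_eq_zero_iff]
    exact ⟨hxl, hx⟩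
  have hne : (x : PowerSeries B).map (IsLocalRing.residue B) ≠ 0 := fun h => by
    rw [h, PowerSeries.order_zero] at hord
    exact ENat.top_ne_natCast _ hord
  obtain ⟨f, h, H⟩ := PowerSeries.exists_isWeierstrassFactorization hne
  have hdeg : f.natDegree = l := by
    rw [H.natDegree_eq_toNat_order_map, hord, ENat.toNat_natCast]
  exact ⟨f, h, H.isDistinguishedAt.monic, hdeg, H.isUnit,
    fun j hj => H.isDistinguishedAt.mem (by rwa [hdeg]), H.eq_mul⟩

theorem exists_surjective_of_universal_factorization {K T : Type*} {B : Type u} [Field K]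
    [CommRing T] [CommRing B] [IsLocalRing B]
    [Algebra K T] {n : ℕ} {lam : Fin n → ℕ} (W : Fin n → Polynomial T)
    (huniv : ∀ (D : Type u) [CommRing D] (g : K →+* D) (V : Fin n → Polynomial D),
        (∀ i, (V i).Monic) → (∀ i, (V i).natDegree = lam i) →
        ∏ i, V i = Polynomial.X ^ (∑ i, lam i) →
        ∃ h : T →+* D, h.comp (algebraMap K T) = g ∧ ∀ i, (W i).map h = V i)
    {M : ℕ} (hM : IsLocalRing.maximalIdeal B ^ M = ⊥) (g : K →+* B)
    (hg : ∀ b, ∃ a, b - g a ∈ IsLocalRing.maximalIdeal B) (x : Fin n → Polynomial B)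
    (hmax : IsLocalRing.maximalIdeal B = Ideal.span {c | ∃ i, ∃ j < lam i, c = (x i).coeff j})
    (hx : ∀ i, (x i).coeff (lam i) ∉ IsLocalRing.maximalIdeal B)
    (hprod : Polynomial.X ^ (∑ i, lam i) ∣ ∏ i, x i) :
    ∃ ψ : T →+* B, Function.Surjective ψ := by
  choose f h hfm hfd hh hf hfh using fun i =>
    IsLocalRing.exists_weierstrass_factorization hM (x i) (lam i)
      (fun j hj => by rw [hmax]; exact Ideal.subset_span ⟨i, j, hj, rfl⟩) (hx i)
  have hfX : ∏ i, f i = Polynomial.X ^ (∑ i, lam i) := by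
    have hm : (∏ i, f i).Monic := Polynomial.monic_prod_of_monic _ _ fun i _ => hfm i
    have hd : (∏ i, f i).natDegree = ∑ i, lam i := by
      rw [Polynomial.natDegree_prod_of_monic _ _ fun i _ => hfm i]
      exact Finset.sum_congr rfl fun i _ => hfd i
    have hdvd : (PowerSeries.X : PowerSeries B) ^ (∑ i, lam i) ∣
        ((∏ i, f i : Polynomial B) : PowerSeries B) := by
      have h1 : (PowerSeries.X : PowerSeries B) ^ (∑ i, lam i) ∣
          ((∏ i, x i : Polynomial B) : PowerSeries B) := by
        obtain ⟨q, hq⟩ := hprod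
        exact ⟨q, by rw [hq]; simp⟩
      have h2 : ((∏ i, x i : Polynomial B) : PowerSeries B) =
          ((∏ i, f i : Polynomial B) : PowerSeries B) * ∏ i, h i := by
        rw [← Polynomial.coeToPowerSeries.ringHom_apply, ← Polynomial.coeToPowerSeries.ringHom_apply,
          map_prod, map_prod, ← Finset.prod_mul_distrib]
        exact Finset.prod_congr rfl fun i _ => hfh i
      rw [h2] at h1
      exact ((IsUnit.prod_univ_iff.mpr hh).dvd_mul_right).mp h1
    rw [hm.as_sum, hd]
    simp only [add_eq_left]
    refine Finset.sum_eq_zero fun j hj => ?_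
    have := PowerSeries.X_pow_dvd_iff.mp hdvd j (Finset.mem_range.mp hj)
    rw [Polynomial.coeff_coe] at this
    simp [this]
  obtain ⟨ψ, hψ, hψW⟩ := huniv B g f hfm hfd hfX
  refine ⟨ψ, ψ.surjective_of_le_map_comap _ hM ?_ fun b => ?_⟩
  · conv_lhs => rw [hmax]
    rw [Ideal.span_le]
    rintro _ ⟨i, j, hj, rfl⟩
    rw [← Polynomial.coeff_coe, hfh, PowerSeries.coeff_mul]
    refine Ideal.sum_mem _ fun a ha => Ideal.mul_mem_right _ _ ?_
    have haj : a.1 < lam i := by have := Finset.HasAntidiagonal.mem_antidiagonal.mp ha; omega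
    rw [Polynomial.coeff_coe]
    have hw : ψ ((W i).coeff a.1) = (f i).coeff a.1 := by rw [← Polynomial.coeff_map, hψW]
    rw [← hw]
    exact Ideal.mem_map_of_mem _ (Ideal.mem_comap.mpr (hw ▸ hf i _ haj))
  · obtain ⟨a, ha⟩ := hg b
    exact ⟨algebraMap K T a, by rwa [← RingHom.comp_apply, hψ]⟩

theorem MvPolynomial.exists_retraction_ker_eq {R τ : Type*} [CommRing R] (s : τ → Prop) :
    ∃ ρ : MvPolynomial τ R →ₐ[R] MvPolynomial {p // ¬ s p} R,
      RingHom.ker ρ = Ideal.span {q | ∃ p, s p ∧ q = X p} ∧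
      (∀ p, s p → ρ (X p) = 0) ∧ (∀ p (hp : ¬ s p), ρ (X p) = X ⟨p, hp⟩) ∧
      (∀ d, ρ (rename Subtype.val d) = d) := by
  classical
  let ρ : MvPolynomial τ R →ₐ[R] MvPolynomial {p // ¬ s p} R :=
    aeval fun p => if hp : s p then 0 else X ⟨p, hp⟩
  have h0 : ∀ p, s p → ρ (X p) = 0 := fun p hp => by simp [ρ, hp]
  have h1 : ∀ p (hp : ¬ s p), ρ (X p) = X ⟨p, hp⟩ := fun p hp => by simp [ρ, hp]
  have h2 : ∀ d, ρ (rename Subtype.val d) = d := by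
    intro d
    have : ρ.comp (rename Subtype.val) = AlgHom.id R _ := by
      ext p
      simp [h1 p.1 p.2]
    exact DFunLike.congr_fun this d
  refine ⟨ρ, le_antisymm ?_ ?_, h0, h1, h2⟩
  · intro f hf
    let π := Ideal.Quotient.mkₐ R (Ideal.span {q : MvPolynomial τ R | ∃ p, s p ∧ q = X p})
    have : (π.comp (rename Subtype.val)).comp ρ = π := by
      ext p
      by_cases hp : s p
      · have : π (X p) = 0 := Ideal.Quotient.eq_zero_iff_mem.mpr (Ideal.subset_span ⟨p, hp, rfl⟩)
        simp [h0 p hp, this]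
      · simp [h1 p hp]
    have h := DFunLike.congr_fun this f
    rw [AlgHom.comp_apply, (RingHom.mem_ker).mp hf, map_zero] at h
    exact Ideal.Quotient.eq_zero_iff_mem.mp h.symm
  · rw [Ideal.span_le]
    rintro _ ⟨p, hp, rfl⟩
    exact h0 p hp

/-- The polynomial `x_i^{(0)} + x_i^{(1)} t + ⋯ + x_i^{(m)} t^m + t^{m+1}`. -/
noncomputable def monicJet (k : Type*) [CommRing k] {n : ℕ} (m : ℕ) (i : Fin n) :
    Polynomial (MvPolynomial (Fin n × Fin (m + 1)) k) :=
  Polynomial.X ^ (m + 1) + ∑ j : Fin (m + 1), Polynomial.C (X (i, j)) * Polynomial.X ^ (j : ℕ)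

section monicJet

variable {k : Type*} [CommRing k] {n m : ℕ}

theorem monicJet_monic (i : Fin n) : (monicJet k m i).Monic :=
  Polynomial.monic_X_pow_add (Polynomial.degree_sum_fin_lt _)

theorem monicJet_natDegree [Nontrivial k] (i : Fin n) : (monicJet k m i).natDegree = m + 1 := by
  rw [monicJet, Polynomial.natDegree_add_eq_left_of_degree_lt, Polynomial.natDegree_X_pow]
  rw [Polynomial.degree_X_pow]
  exact Polynomial.degree_sum_fin_lt _

theorem monicJet_coeff (i : Fin n) (j : Fin (m + 1)) : (monicJet k m i).coeff j = X (i, j) := by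
  simp only [monicJet, Polynomial.coeff_add, Polynomial.coeff_X_pow, Polynomial.finsetSum_coeff,
    Polynomial.coeff_C_mul]
  rw [if_neg j.2.ne, zero_add, Finset.sum_eq_single j]
  · simp
  · intro b _ hb
    rw [if_neg (fun h => hb (Fin.ext h.symm)), mul_zero]
  · simp

theorem monicJet_coeff_eq_or [Nontrivial k] (i : Fin n) {l : ℕ} (hl : l ≤ m + 1) :
    (∃ j : Fin (m + 1), (j : ℕ) = l ∧ (monicJet k m i).coeff l = X (i, j)) ∨
      (monicJet k m i).coeff l = 1 := by
  rcases hl.lt_or_eq with h | rfl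
  · exact .inl ⟨⟨l, h⟩, rfl, monicJet_coeff i ⟨l, h⟩⟩
  · exact .inr (by
      have := (monicJet_monic (k := k) (m := m) i).coeff_natDegree
      rwa [monicJet_natDegree] at this)

theorem coeff_prod_monicJet {d : ℕ} (hd : d ≤ m) :
    (∏ i : Fin n, monicJet k m i).coeff d =
      (∏ i : Fin n, ∑ j : Fin (m + 1),
        Polynomial.C (X (i, j) : MvPolynomial (Fin n × Fin (m + 1)) k) *
          Polynomial.X ^ (j : ℕ)).coeff d := by
  have h : Polynomial.X ^ (m + 1) ∣ (∏ i : Fin n, monicJet k m i) -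
      (∏ i : Fin n, ∑ j : Fin (m + 1),
        Polynomial.C (X (i, j) : MvPolynomial (Fin n × Fin (m + 1)) k) *
          Polynomial.X ^ (j : ℕ)) := by
    rw [← Ideal.mem_span_singleton, ← Ideal.Quotient.eq, map_prod, map_prod]
    refine Finset.prod_congr rfl fun i _ => ?_
    rw [Ideal.Quotient.eq, Ideal.mem_span_singleton, monicJet, add_sub_cancel_right]
  have := Polynomial.X_pow_dvd_iff.mp h d (by omega)
  rwa [Polynomial.coeff_sub, sub_eq_zero] at this

end monicJet

theorem exists_hom_of_universal_factorization {k K T : Type*} [Field k] [Field K] [CommRing T]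
    [Algebra K T] {n m : ℕ} {lam : Fin n → ℕ} (hlam : ∀ i, lam i ≤ m + 1) (W : Fin n → Polynomial T)
    (hWm : ∀ i, (W i).Monic) (hWd : ∀ i, (W i).natDegree = lam i)
    (ρ : MvPolynomial (Fin n × Fin (m + 1)) k →+* K)
    (hρ₀ : ∀ i (j : Fin (m + 1)), (j : ℕ) < lam i → ρ (X (i, j)) = 0)
    (hρ₁ : ∀ i (j : Fin (m + 1)), (j : ℕ) = lam i → ρ (X (i, j)) ≠ 0) :
    ∃ (g : MvPolynomial (Fin n × Fin (m + 1)) k →+* T) (U : Fin n → Polynomial T),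
      (∀ i, (monicJet k m i).map g = W i * U i) ∧ (∀ i, IsUnit ((U i).coeff 0)) ∧
      ∀ f, g f - algebraMap K T (ρ f) ∈
        Ideal.span {c | ∃ i, ∃ j < lam i, c = (W i).coeff j} := by
  rcases subsingleton_or_nontrivial T with hT | hT
  · refine ⟨(algebraMap K T).comp ρ, 0, fun i => Subsingleton.elim _ _, fun i => ?_, fun f => ?_⟩
    · exact isUnit_of_subsingleton _
    · simp
  have hdvd : ∀ i, Polynomial.X ^ lam i ∣ (monicJet k m i).map ρ := fun i => by
    rw [Polynomial.X_pow_dvd_iff]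
    intro d hd
    have := hlam i
    rw [Polynomial.coeff_map, monicJet_coeff i ⟨d, by omega⟩, hρ₀ _ _ hd]
  choose V hV using hdvd
  have hVm : ∀ i, (V i).Monic := fun i =>
    (Polynomial.monic_X_pow (lam i)).of_mul_monic_left (hV i ▸ (monicJet_monic i).map _)
  have hVd : ∀ i, lam i + (V i).natDegree = m + 1 := fun i => by
    have := congrArg Polynomial.natDegree (hV i)
    rw [(monicJet_monic i).natDegree_map, monicJet_natDegree,
      (Polynomial.monic_X_pow _).natDegree_mul (hVm i), Polynomial.natDegree_X_pow] at this
    exact this.symm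
  have hV0 : ∀ i, (V i).coeff 0 ≠ 0 := fun i => by
    have h1 : (V i).coeff 0 = ρ ((monicJet k m i).coeff (lam i)) := by
      rw [← Polynomial.coeff_map, hV, Polynomial.coeff_X_pow_mul', if_pos le_rfl, Nat.sub_self]
    rw [h1]
    rcases monicJet_coeff_eq_or (k := k) i (hlam i) with ⟨j, hj, h⟩ | h
    · rw [h]; exact hρ₁ i j hj
    · rw [h, map_one]; exact one_ne_zero
  let U : Fin n → Polynomial T := fun i => (V i).map (algebraMap K T)
  let g : MvPolynomial (Fin n × Fin (m + 1)) k →+* T :=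
    eval₂Hom (((algebraMap K T).comp ρ).comp C) fun p => (W p.1 * U p.1).coeff p.2
  have hgC : ∀ a, g (C a) = algebraMap K T (ρ (C a)) := fun a => eval₂Hom_C _ _ _
  have hgX : ∀ i j, g (X (i, j)) = (W i * U i).coeff j := fun i j => eval₂Hom_X' _ _ _
  have hWU : ∀ i, (W i * U i).Monic := fun i => (hWm i).mul ((hVm i).map _)
  have hWUd : ∀ i, (W i * U i).natDegree = m + 1 := fun i => by
    rw [(hWm i).natDegree_mul ((hVm i).map _), hWd, (hVm i).natDegree_map, hVd]
  refine ⟨g, U, fun i => ?_, fun i => ?_, ?_⟩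
  · conv_rhs => rw [(hWU i).as_sum, hWUd i, ← Fin.sum_univ_eq_sum_range
      (fun j => Polynomial.C ((W i * U i).coeff j) * Polynomial.X ^ j)]
    simp [monicJet, hgX, Polynomial.map_sum]
  · rw [Polynomial.coeff_map]
    exact (IsUnit.mk0 _ (hV0 i)).map _
  · set I := Ideal.span {c | ∃ i, ∃ j < lam i, c = (W i).coeff j} with hI
    have hWI : ∀ i, (W i).map (Ideal.Quotient.mk I) = Polynomial.X ^ lam i := fun i => by
      conv_lhs => rw [(hWm i).as_sum, hWd i]
      rw [Polynomial.map_add, Polynomial.map_pow, Polynomial.map_X, Polynomial.map_sum,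
        add_eq_left]
      refine Finset.sum_eq_zero fun j hj => ?_
      have : Ideal.Quotient.mk I ((W i).coeff j) = 0 :=
        Ideal.Quotient.eq_zero_iff_mem.mpr
          (Ideal.subset_span ⟨i, j, Finset.mem_range.mp hj, rfl⟩)
      simp [this]
    have heq : (Ideal.Quotient.mk I).comp g =
        (Ideal.Quotient.mk I).comp ((algebraMap K T).comp ρ) := by
      refine MvPolynomial.ringHom_ext (fun a => ?_) fun ⟨i, j⟩ => ?_
      · simp [hgC]
      · rw [RingHom.comp_apply, RingHom.comp_apply, hgX, ← Polynomial.coeff_map,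
          Polynomial.map_mul, hWI, Polynomial.map_map, ← monicJet_coeff, RingHom.comp_apply,
          ← Polynomial.coeff_map ρ, hV, ← RingHom.comp_apply, ← Polynomial.coeff_map]
        simp
    intro f
    rw [← Ideal.Quotient.eq]
    exact RingHom.congr_fun heq f

theorem IsLocalRing.exists_maximalIdeal_pow_eq_bot {B : Type*} [CommRing B] [IsLocalRing B]
    [IsNoetherianRing B] {n : ℕ} {lam : Fin n → ℕ} (x : Fin n → Polynomial B)
    (hmax : IsLocalRing.maximalIdeal B = Ideal.span {c | ∃ i, ∃ j < lam i, c = (x i).coeff j})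
    (hx : ∀ i, (x i).coeff (lam i) ∉ IsLocalRing.maximalIdeal B)
    (hprod : Polynomial.X ^ (∑ i, lam i) ∣ ∏ i, x i) :
    ∃ M, IsLocalRing.maximalIdeal B ^ M = ⊥ := by
  have hle : IsLocalRing.maximalIdeal B ≤ nilradical B := by
    rw [hmax, Ideal.span_le]
    rintro _ ⟨i, j, hj, rfl⟩
    rw [SetLike.mem_coe, mem_nilradical, nilpotent_iff_mem_prime]
    intro Q hQ
    have hdvd : Polynomial.X ^ (∑ i, lam i) ∣ ∏ i, (x i).map (Ideal.Quotient.mk Q) := by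
      have := map_dvd (Polynomial.mapRingHom (Ideal.Quotient.mk Q)) hprod
      simpa [map_prod] using this
    have h := Polynomial.X_pow_dvd_of_X_pow_dvd_prod (fun i => ?_) hdvd i
    · have := Polynomial.X_pow_dvd_iff.mp h j hj
      rwa [Polynomial.coeff_map, Ideal.Quotient.eq_zero_iff_mem] at this
    · rw [Polynomial.coeff_map, ne_eq, Ideal.Quotient.eq_zero_iff_mem]
      exact fun h => hx i (IsLocalRing.le_maximalIdeal hQ.ne_top h)
  obtain ⟨M, hM⟩ := IsNoetherianRing.isNilpotent_nilradical B
  exact ⟨M, le_bot_iff.mp ((Ideal.pow_right_mono hle M).trans hM.le)⟩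

theorem exists_surjective_to_universal_factorization {k K T B : Type*} [Field k] [Field K]
    [CommRing T] [Algebra K T] [CommRing B] {n m : ℕ} {lam : Fin n → ℕ}
    (hlam : ∑ i, lam i = m + 1) (W : Fin n → Polynomial T)
    (hWm : ∀ i, (W i).Monic) (hWd : ∀ i, (W i).natDegree = lam i)
    (hWX : ∏ i, W i = Polynomial.X ^ (∑ i, lam i)) {M : ℕ}
    (hM : Ideal.span {c | ∃ i, ∃ j < lam i, c = (W i).coeff j} ^ M = ⊥)
    (hT : ∀ t, ∃ a, t - algebraMap K T a ∈ Ideal.span {c | ∃ i, ∃ j < lam i, c = (W i).coeff j})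
    (ρ : MvPolynomial (Fin n × Fin (m + 1)) k →+* K)
    (hρ₀ : ∀ i (j : Fin (m + 1)), (j : ℕ) < lam i → ρ (X (i, j)) = 0)
    (hρ₁ : ∀ i (j : Fin (m + 1)), (j : ℕ) = lam i → ρ (X (i, j)) ≠ 0)
    (hρ₂ : ∀ a, ∃ f s, ρ s ≠ 0 ∧ a * ρ s = ρ f)
    (π : MvPolynomial (Fin n × Fin (m + 1)) k →+* B)
    (hπ : ∀ s, ρ s ≠ 0 → IsUnit (π s))
    (hlift : ∀ g : MvPolynomial (Fin n × Fin (m + 1)) k →+* T,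
      (∀ d ≤ m, g ((∏ i, monicJet k m i).coeff d) = 0) → (∀ f, ρ f ≠ 0 → IsUnit (g f)) →
      ∃ φ : B →+* T, φ.comp π = g) :
    ∃ φ : B →+* T, Function.Surjective φ := by
  have hle : ∀ i, lam i ≤ m + 1 := fun i =>
    hlam ▸ Finset.single_le_sum (fun _ _ => Nat.zero_le _) (Finset.mem_univ i)
  obtain ⟨g, U, hgU, hU, hgρ⟩ :=
    exists_hom_of_universal_factorization hle W hWm hWd ρ hρ₀ hρ₁
  set I := Ideal.span {c | ∃ i, ∃ j < lam i, c = (W i).coeff j} with hI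
  have hgJ : ∀ d ≤ m, g ((∏ i, monicJet k m i).coeff d) = 0 := by
    intro d hd
    rw [← Polynomial.coeff_map, Polynomial.map_prod, Finset.prod_congr rfl fun i _ => hgU i,
      Finset.prod_mul_distrib, hWX, hlam, Polynomial.coeff_X_pow_mul', if_neg (by omega)]
  have hgu : ∀ f, ρ f ≠ 0 → IsUnit (g f) := by
    intro f hf
    have h1 : IsNilpotent (g f - algebraMap K T (ρ f)) :=
      ⟨M, by simpa [hM] using Ideal.pow_mem_pow (hgρ f) M⟩
    have h2 : IsUnit (algebraMap K T (ρ f)) := (IsUnit.mk0 _ hf).map _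
    have := h1.isUnit_add_left_of_commute h2 (Commute.all _ _)
    simpa using this
  obtain ⟨φ, rfl⟩ := hlift g hgJ hgu
  refine ⟨φ, RingHom.surjective_of_le_map_comap φ I hM ?_ fun t => ?_⟩
  · rw [hI, Ideal.span_le, ← hI]
    rintro _ ⟨i, j, hj, rfl⟩
    set L := (I.comap φ).map φ with hL
    have hdvd : Polynomial.X ^ lam i ∣
        (W i).map (Ideal.Quotient.mk L) * (U i).map (Ideal.Quotient.mk L) := by
      rw [← Polynomial.map_mul, ← hgU, Polynomial.X_pow_dvd_iff]
      intro d hd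
      rw [Polynomial.coeff_map, Polynomial.coeff_map, Ideal.Quotient.eq_zero_iff_mem,
        RingHom.comp_apply]
      refine Ideal.mem_map_of_mem _ ?_
      have := hle i
      rw [Ideal.mem_comap, monicJet_coeff i ⟨d, by omega⟩]
      have h := hgρ (X (i, ⟨d, by omega⟩))
      rwa [hρ₀ _ _ hd, map_zero, sub_zero] at h
    have h := Polynomial.X_pow_dvd_of_X_pow_dvd_mul
      (by rw [Polynomial.coeff_map]; exact (hU i).map _) hdvd
    have := Polynomial.X_pow_dvd_iff.mp h j hj
    rwa [Polynomial.coeff_map, Ideal.Quotient.eq_zero_iff_mem] at this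
  · obtain ⟨a, ha⟩ := hT t
    obtain ⟨f, s, hs, hfs⟩ := hρ₂ a
    obtain ⟨v, hv⟩ := (hπ s hs).exists_right_inv
    refine ⟨π f * v, ?_⟩
    rw [← Ideal.Quotient.eq] at ha ⊢
    have hf := Ideal.Quotient.eq.mpr (hgρ f)
    have hs' := Ideal.Quotient.eq.mpr (hgρ s)
    rw [RingHom.comp_apply] at hf hs'
    have hv' : Ideal.Quotient.mk I (φ (π s)) * Ideal.Quotient.mk I (φ v) = 1 := by
      rw [← map_mul, ← map_mul, hv, map_one, map_one]
    rw [map_mul, map_mul, ha, hf, ← hfs, map_mul, map_mul, ← hs', mul_assoc, hv', mul_one]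

theorem exists_surjective_from_universal_factorization {k : Type*} {K T : Type*} {B : Type u}
    [Field k] [Field K] [CommRing T] [Algebra K T] [CommRing B] [IsLocalRing B]
    [IsNoetherianRing B] {n m : ℕ} {lam : Fin n → ℕ}
    (hlam : ∑ i, lam i = m + 1) (W : Fin n → Polynomial T)
    (huniv : ∀ (D : Type u) [CommRing D] (g : K →+* D) (V : Fin n → Polynomial D),
        (∀ i, (V i).Monic) → (∀ i, (V i).natDegree = lam i) →
        ∏ i, V i = Polynomial.X ^ (∑ i, lam i) →
        ∃ h : T →+* D, h.comp (algebraMap K T) = g ∧ ∀ i, (W i).map h = V i)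
    (g : K →+* B) (hg : ∀ b, ∃ a, b - g a ∈ IsLocalRing.maximalIdeal B)
    (π : MvPolynomial (Fin n × Fin (m + 1)) k →+* B)
    (hmax : IsLocalRing.maximalIdeal B =
      (Ideal.span {q | ∃ (i : Fin n) (j : Fin (m + 1)), (j : ℕ) < lam i ∧ q = X (i, j)}).map π)
    (hπ₀ : ∀ d ≤ m, π ((∏ i, monicJet k m i).coeff d) = 0)
    (hπ₁ : ∀ i (j : Fin (m + 1)), (j : ℕ) = lam i → IsUnit (π (X (i, j)))) :
    ∃ ψ : T →+* B, Function.Surjective ψ := by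
  have hle : ∀ i, lam i ≤ m + 1 := fun i =>
    hlam ▸ Finset.single_le_sum (fun _ _ => Nat.zero_le _) (Finset.mem_univ i)
  let x : Fin n → Polynomial B := fun i => (monicJet k m i).map π
  have hmax' : IsLocalRing.maximalIdeal B =
      Ideal.span {c | ∃ i, ∃ j < lam i, c = (x i).coeff j} := by
    rw [hmax, Ideal.map_span]
    congr 1
    ext c
    constructor
    · rintro ⟨_, ⟨i, j, hj, rfl⟩, rfl⟩
      exact ⟨i, j, hj, by rw [Polynomial.coeff_map, monicJet_coeff]⟩
    · rintro ⟨i, j, hj, rfl⟩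
      have := hle i
      exact ⟨_, ⟨i, ⟨j, by omega⟩, hj, rfl⟩,
        by rw [Polynomial.coeff_map, ← monicJet_coeff]⟩
  have hx : ∀ i, (x i).coeff (lam i) ∉ IsLocalRing.maximalIdeal B := by
    intro i
    rw [IsLocalRing.mem_maximalIdeal, mem_nonunits_iff, not_not, Polynomial.coeff_map]
    rcases monicJet_coeff_eq_or (k := k) i (hle i) with ⟨j, hj, h⟩ | h
    · rw [h]; exact hπ₁ i j hj
    · rw [h, map_one]; exact isUnit_one
  have hprod : Polynomial.X ^ (∑ i, lam i) ∣ ∏ i, x i := by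
    rw [← Polynomial.map_prod, Polynomial.X_pow_dvd_iff, hlam]
    intro d hd
    rw [Polynomial.coeff_map, hπ₀ d (by omega)]
  obtain ⟨M, hM⟩ := IsLocalRing.exists_maximalIdeal_pow_eq_bot x hmax' hx hprod
  exact exists_surjective_of_universal_factorization W huniv hM g hg x hmax' hx hprod

theorem Module.exists_compositionSeries_of_length_eq {A M : Type*} [Ring A] [AddCommGroup M]
    [Module A M] {N : ℕ} (h : Module.length A M = N) :
    ∃ s : CompositionSeries (Submodule A M), s.head = ⊥ ∧ s.last = ⊤ ∧ s.length = N := by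
  have hfin : IsFiniteLength A M := Module.length_ne_top_iff.mp (by simp [h])
  obtain ⟨s, h₁, h₂⟩ := isFiniteLength_iff_exists_compositionSeries.mp hfin
  refine ⟨s, h₁, h₂, ?_⟩
  have := Module.length_compositionSeries s h₁ h₂
  rw [h] at this
  exact_mod_cast this

theorem length_localization_jet {k : Type u} [Field k] {n m : ℕ} {lam : Fin n → ℕ}
    (hlam : ∑ i, lam i = m + 1)
    (ρ : MvPolynomial (Fin n × Fin (m + 1)) k →ₐ[k]
      MvPolynomial {p : Fin n × Fin (m + 1) // ¬ (p.2 : ℕ) < lam p.1} k)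
    (hker : RingHom.ker ρ = Ideal.span
      {q | ∃ (i : Fin n) (j : Fin (m + 1)), (j : ℕ) < lam i ∧ q = X (i, j)})
    (hρ₁ : ∀ p (hp : ¬ (p.2 : ℕ) < lam p.1), ρ (X p) = X ⟨p, hp⟩)
    (hρ₂ : ∀ d, ρ (rename Subtype.val d) = d)
    {J : Ideal (MvPolynomial (Fin n × Fin (m + 1)) k)}
    (hJ : J = Ideal.span {q | ∃ d ≤ m, q = (∏ i : Fin n, monicJet k m i).coeff d})
    (hJρ : J ≤ RingHom.ker ρ)
    [((RingHom.ker ρ).map (Ideal.Quotient.mk J)).IsPrime] :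
    let B := Localization.AtPrime ((RingHom.ker ρ).map (Ideal.Quotient.mk J))
    Module.length B B = ((m + 1).factorial / ∏ i, (lam i).factorial : ℕ) := by
  intro B
  let D := MvPolynomial {p : Fin n × Fin (m + 1) // ¬ (p.2 : ℕ) < lam p.1} k
  let K := FractionRing D
  let 𝔮 := (RingHom.ker ρ).map (Ideal.Quotient.mk J)
  obtain ⟨T, _, _, W, hWm, hWd, hWX, ⟨M, hM⟩, hT, hlen, huniv⟩ :=
    exists_universal_factorization_X_pow_length K lam
  let π : MvPolynomial (Fin n × Fin (m + 1)) k →+* B :=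
    (algebraMap (MvPolynomial (Fin n × Fin (m + 1)) k ⧸ J) B).comp (Ideal.Quotient.mk J)
  let ρ' : MvPolynomial (Fin n × Fin (m + 1)) k →+* K := (algebraMap D K).comp ρ.toRingHom
  have hρ' : ∀ f, ρ' f = 0 ↔ ρ f = 0 := fun f =>
    map_eq_zero_iff (algebraMap D K) (IsFractionRing.injective D K)
  have hmk : ∀ f, Ideal.Quotient.mk J f ∈ 𝔮 ↔ ρ f = 0 := fun f =>
    (Ideal.mem_quotient_iff_mem hJρ).trans RingHom.mem_ker
  have hπu : ∀ f, ρ f ≠ 0 → IsUnit (π f) := fun f hf =>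
    IsLocalization.map_units B (⟨Ideal.Quotient.mk J f, (hmk f).not.mpr hf⟩ : 𝔮.primeCompl)
  have hmax : IsLocalRing.maximalIdeal B = (RingHom.ker ρ).map π := by
    rw [← Localization.AtPrime.map_eq_maximalIdeal, Ideal.map_map]
  have hπ₀ : ∀ d ≤ m, π ((∏ i, monicJet k m i).coeff d) = 0 := fun d hd => by
    have : Ideal.Quotient.mk J ((∏ i, monicJet k m i).coeff d) = 0 :=
      Ideal.Quotient.eq_zero_iff_mem.mpr (hJ ▸ Ideal.subset_span ⟨d, hd, rfl⟩)
    rw [RingHom.comp_apply, this, map_zero]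
  have hX₀ : ∀ i (j : Fin (m + 1)), (j : ℕ) < lam i → ρ (X (i, j)) = 0 := fun i j hj => by
    rw [← RingHom.mem_ker, hker]
    exact Ideal.subset_span ⟨i, j, hj, rfl⟩
  have hX₁ : ∀ i (j : Fin (m + 1)), (j : ℕ) = lam i → ρ (X (i, j)) ≠ 0 := fun i j hj => by
    rw [hρ₁ (i, j) hj.not_lt]
    exact X_ne_zero _
  have hsurj : ∀ b : B, ∃ f s, ρ s ≠ 0 ∧ b * π s = π f := by
    intro b
    obtain ⟨⟨r, s, hs⟩, h⟩ := IsLocalization.surj 𝔮.primeCompl b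
    obtain ⟨f, rfl⟩ := Ideal.Quotient.mk_surjective r
    obtain ⟨s, rfl⟩ := Ideal.Quotient.mk_surjective s
    exact ⟨f, s, (hmk s).not.mp hs, h⟩
  have : IsNoetherianRing B := IsLocalization.isNoetherianRing 𝔮.primeCompl B inferInstance
  rw [hlam] at hlen
  rw [← hlen]
  refine le_antisymm ?_ ?_
  · let κ₀ : D →+* B := π.comp (rename Subtype.val).toRingHom
    have hκ₀ : ∀ d : nonZeroDivisors D, IsUnit (κ₀ d) := fun d =>
      hπu _ (by
        rw [AlgHom.toRingHom_eq_coe, RingHom.coe_coe, hρ₂]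
        exact nonZeroDivisors.ne_zero d.2)
    let κ : K →+* B := IsLocalization.lift hκ₀
    have hκ : ∀ d, κ (algebraMap D K d) = κ₀ d := fun d => IsLocalization.lift_eq hκ₀ d
    have hres : ∀ f, π f - κ (algebraMap D K (ρ f)) ∈ IsLocalRing.maximalIdeal B := by
      intro f
      have : π f - κ (algebraMap D K (ρ f)) = π (f - rename Subtype.val (ρ f)) := by
        rw [hκ, map_sub]; rfl
      rw [this, hmax]
      exact Ideal.mem_map_of_mem _ (by rw [RingHom.mem_ker, map_sub, hρ₂, sub_self])
    have hκs : ∀ b, ∃ a, b - κ a ∈ IsLocalRing.maximalIdeal B := by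
      intro b
      obtain ⟨f, s, hs, h⟩ := hsurj b
      refine ⟨algebraMap D K (ρ f) / algebraMap D K (ρ s), ?_⟩
      have hs0 : algebraMap D K (ρ s) ≠ 0 := (hρ' s).not.mpr hs
      have hu : κ (algebraMap D K (ρ f) / algebraMap D K (ρ s)) * κ (algebraMap D K (ρ s)) =
          κ (algebraMap D K (ρ f)) := by rw [← map_mul, div_mul_cancel₀ _ hs0]
      have hmod : ∀ x y : B, x - y ∈ IsLocalRing.maximalIdeal B ↔
          IsLocalRing.residue B x = IsLocalRing.residue B y := fun x y => by
        rw [← sub_eq_zero, ← map_sub]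
        exact (IsLocalRing.residue_eq_zero_iff (x - y)).symm
      have h1 := (hmod _ _).mp (hres f)
      have h2 := (hmod _ _).mp (hres s)
      rw [hmod]
      have h3 : IsLocalRing.residue B (π s) ≠ 0 := ((hπu s hs).map _).ne_zero
      refine mul_right_cancel₀ h3 ?_
      rw [← map_mul, h, h1, ← hu, map_mul, h2]
    obtain ⟨ψ, hψ⟩ := exists_surjective_from_universal_factorization (B := B) hlam W huniv κ hκs π
      (hmax.trans (congrArg (Ideal.map π) hker)) hπ₀ (fun i j hj => hπu _ (hX₁ i j hj))
    exact Module.length_self_le_of_surjective ψ hψ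
  · have hfrac : ∀ a, ∃ f s, ρ' s ≠ 0 ∧ a * ρ' s = ρ' f := by
      intro a
      obtain ⟨⟨d, s⟩, h⟩ := IsLocalization.surj (nonZeroDivisors D) a
      refine ⟨rename Subtype.val d, rename Subtype.val s.1, ?_, ?_⟩
      · rw [ne_eq, hρ', hρ₂]
        exact nonZeroDivisors.ne_zero s.2
      · simpa [ρ', hρ₂] using h
    have hlift : ∀ g : MvPolynomial (Fin n × Fin (m + 1)) k →+* T,
        (∀ d ≤ m, g ((∏ i, monicJet k m i).coeff d) = 0) → (∀ f, ρ' f ≠ 0 → IsUnit (g f)) →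
        ∃ φ : B →+* T, φ.comp π = g := by
      intro g hg hgu
      have hgJ : ∀ f ∈ J, g f = 0 := by
        have : J ≤ RingHom.ker g := by
          rw [hJ, Ideal.span_le]
          rintro _ ⟨d, hd, rfl⟩
          exact hg d hd
        exact this
      have hu : ∀ s : 𝔮.primeCompl, IsUnit (Ideal.Quotient.lift J g hgJ s) := by
        rintro ⟨s, hs⟩
        obtain ⟨s, rfl⟩ := Ideal.Quotient.mk_surjective s
        exact hgu s ((hρ' s).not.mpr ((hmk s).not.mp hs))
      refine ⟨IsLocalization.lift hu, ?_⟩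
      ext f <;> simp [π]
    obtain ⟨φ, hφ⟩ := exists_surjective_to_universal_factorization (B := B) hlam W hWm hWd
      hWX hM hT ρ' (fun i j hj => (hρ' _).mpr (hX₀ i j hj))
      (fun i j hj => (hρ' _).not.mpr (hX₁ i j hj)) hfrac π
      (fun s hs => hπu s ((hρ' s).not.mp hs)) hlift
    exact Module.length_self_le_of_surjective φ hφ

/-- With `R_m = k[x_i^{(j)} : 1 ≤ i ≤ n, 0 ≤ j ≤ m]`,
`J_m(x_1⋯x_n)` the ideal generated by the coefficients of `t^0,…,t^m` in
`∏_i (x_i^{(0)} + ⋯ + x_i^{(m)} t^m)`, and `𝔭_λ` the prime generated by the `x_i^{(j)}`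
with `j < λ_i` (`∑ λ_i = m + 1`), the localization `B = (R_m/J_m)_{𝔭_λ}` has finite
length as a module over itself, and this length (the multiplicity of `J_m` along `𝔭_λ`)
equals `(m+1)!/(λ_1! ⋯ λ_n!)`; we express this by a composition series of the
`B`-module `B` from `⊥` to `⊤` of length `(m+1)!/(λ_1! ⋯ λ_n!)`. -/
theorem jet_multiplicity
    (k : Type*) [Field k] [CharZero k] (n m : ℕ) (hn : 0 < n) (hm : 0 < m)
    (lam : Fin n → ℕ) (hlam : ∑ i, lam i = m + 1)
    (P : Polynomial (MvPolynomial (Fin n × Fin (m + 1)) k))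
    (hP : P = ∏ i : Fin n, ∑ j : Fin (m + 1),
      Polynomial.C (X (i, j)) * Polynomial.X ^ (j : ℕ))
    (J : Ideal (MvPolynomial (Fin n × Fin (m + 1)) k))
    (hJ : J = Ideal.span {q | ∃ d ≤ m, q = P.coeff d})
    (𝔭 : Ideal (MvPolynomial (Fin n × Fin (m + 1)) k))
    (h𝔭 : 𝔭 = Ideal.span
      {q | ∃ (i : Fin n) (j : Fin (m + 1)), (j : ℕ) < lam i ∧ q = X (i, j)}) :
    ∃ hp : (𝔭.map (Ideal.Quotient.mk J)).IsPrime,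
      ∃ s : CompositionSeries
        (Submodule (Localization (@Ideal.primeCompl _ _ (𝔭.map (Ideal.Quotient.mk J)) hp))
          (Localization (@Ideal.primeCompl _ _ (𝔭.map (Ideal.Quotient.mk J)) hp))),
        s.head = ⊥ ∧ s.last = ⊤ ∧
          s.length = (m + 1).factorial / ∏ i, (lam i).factorial := by
  have hPc : ∀ d ≤ m, P.coeff d = (∏ i : Fin n, monicJet k m i).coeff d := fun d hd => by
    rw [hP, coeff_prod_monicJet hd]
  obtain ⟨ρ, hker, hρ₀, hρ₁, hρ₂⟩ := MvPolynomial.exists_retraction_ker_eq (R := k)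
    fun p : Fin n × Fin (m + 1) => (p.2 : ℕ) < lam p.1
  have hker' : RingHom.ker ρ = 𝔭 := by
    rw [hker, h𝔭]
    simp only [Prod.exists]
  have hJ' : J = Ideal.span {q | ∃ d ≤ m, q = (∏ i : Fin n, monicJet k m i).coeff d} := by
    rw [hJ]
    congr 1
    ext q
    exact exists_congr fun d => and_congr_right fun hd => by rw [hPc d hd]
  have hle : ∀ i, lam i ≤ m + 1 := fun i =>
    hlam ▸ Finset.single_le_sum (fun _ _ => Nat.zero_le _) (Finset.mem_univ i)
  have hJρ : J ≤ RingHom.ker ρ := by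
    rw [hJ', Ideal.span_le]
    rintro _ ⟨d, hd, rfl⟩
    have hdvd : Polynomial.X ^ (m + 1) ∣
        (∏ i : Fin n, monicJet k m i).map ρ.toRingHom := by
      rw [Polynomial.map_prod]
      refine (dvd_of_eq ?_).trans (Finset.prod_dvd_prod_of_dvd (fun i => Polynomial.X ^ lam i) _
        fun i _ => ?_)
      · rw [Finset.prod_pow_eq_pow_sum, hlam]
      rw [Polynomial.X_pow_dvd_iff]
      intro e he
      have := hle i
      rw [Polynomial.coeff_map, monicJet_coeff i ⟨e, by omega⟩]
      exact hρ₀ (i, ⟨e, by omega⟩) he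
    have := Polynomial.X_pow_dvd_iff.mp hdvd d (by omega)
    rwa [Polynomial.coeff_map] at this
  rw [← hker'] at h𝔭 ⊢
  have := RingHom.ker_isPrime ρ
  have hp : ((RingHom.ker ρ).map (Ideal.Quotient.mk J)).IsPrime :=
    Ideal.map_isPrime_of_surjective Ideal.Quotient.mk_surjective (by rwa [Ideal.mk_ker])
  exact ⟨hp, Module.exists_compositionSeries_of_length_eq
    (length_localization_jet hlam ρ h𝔭 hρ₁ hρ₂ hJ' hJρ)⟩
end

section
/- Let n, m be positive integers and λ = (λ_1,…,λ_n) ∈ ℤ_{≥0}^n with λ_1+⋯+λ_n = m+1. Then there exists a surjective ring homomorphism from C_λ(K_λ) onto the localization (R_m/J_m(x_1⋯x_n))_{𝔭_λ}. -/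
open MvPolynomial

set_option synthInstance.maxHeartbeats 1000000
set_option maxHeartbeats 1000000

theorem IsAdicComplete.of_isNilpotent {A : Type*} [CommRing A] {I : Ideal A}
    (hI : IsNilpotent I) : IsAdicComplete I A := by
  obtain ⟨N, hN⟩ := hI
  refine { haus' := fun x hx => ?_, prec' := fun f hf => ⟨f N, fun n => ?_⟩ }
  · simpa [hN, SModEq.zero] using hx N
  · rcases le_total n N with h | h
    · exact hf h
    · have := hf h
      rw [hN, Ideal.zero_eq_bot, Submodule.bot_smul, SModEq.bot] at this
      rw [this]

theorem RingHom.surjective_of_isNilpotent_span {A B : Type*} [CommRing A] [CommRing B]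
    (g : B →+* A) {S : Set A} (hS : S ⊆ Set.range g) (hnil : IsNilpotent (Ideal.span S))
    (hg : ∀ a, ∃ b, a - g b ∈ Ideal.span S) : Function.Surjective g := by
  have hlift (N : ℕ) : ∀ x ∈ Ideal.span S ^ N, ∃ c, x - g c ∈ Ideal.span S ^ (N + 1) := by
    induction N with
    | zero => simpa using hg
    | succ N ih =>
      intro x hx
      rw [pow_succ] at hx
      induction hx using Submodule.mul_induction_on' with
      | mem_mul_mem u hu v hv =>
        induction hv using Submodule.span_induction generalizing u with
        | mem s hs =>
          obtain ⟨b, rfl⟩ := hS hs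
          obtain ⟨c, hc⟩ := ih u hu
          refine ⟨c * b, ?_⟩
          rw [map_mul, ← sub_mul, pow_succ _ (N + 1)]
          exact Ideal.mul_mem_mul hc (Ideal.subset_span hs)
        | zero => exact ⟨0, by simp⟩
        | add v w _ _ hv hw =>
          obtain ⟨b, hb⟩ := hv u hu
          obtain ⟨c, hc⟩ := hw u hu
          refine ⟨b + c, ?_⟩
          rw [map_add, mul_add, add_sub_add_comm]
          exact add_mem hb hc
        | smul a v _ hv =>
          rw [smul_eq_mul, ← mul_assoc]
          exact hv _ (Ideal.mul_mem_right a _ hu)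
      | add x _ y _ hx hy =>
        obtain ⟨b, hb⟩ := hx
        obtain ⟨c, hc⟩ := hy
        refine ⟨b + c, ?_⟩
        rw [map_add, add_sub_add_comm]
        exact add_mem hb hc
  have hpow (N : ℕ) (a : A) : ∃ b, a - g b ∈ Ideal.span S ^ N := by
    induction N with
    | zero => exact ⟨0, by simp⟩
    | succ N ih =>
      obtain ⟨b, hb⟩ := ih
      obtain ⟨c, hc⟩ := hlift N _ hb
      exact ⟨b + c, by rwa [map_add, ← sub_sub]⟩
  obtain ⟨N, hN⟩ := hnil
  intro a
  obtain ⟨b, hb⟩ := hpow N a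
  rw [hN, Ideal.zero_eq_bot, Ideal.mem_bot, sub_eq_zero] at hb
  exact ⟨b, hb.symm⟩

namespace PowerSeries

theorem X_pow_dvd_of_X_pow_sum_dvd_prod {D ι : Type*} [CommRing D] [IsDomain D] [Fintype ι]
    {F : ι → D⟦X⟧} {d : ι → ℕ} (hdvd : (X : D⟦X⟧) ^ (∑ i, d i) ∣ ∏ i, F i)
    (hF : ∀ i, coeff (d i) (F i) ≠ 0) (i : ι) : (X : D⟦X⟧) ^ d i ∣ F i := by
  have hne (j : ι) : F j ≠ 0 := fun h => hF j (by simp [h])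
  have hle : ∀ j ∈ Finset.univ, (F j).order.toNat ≤ d j := fun j _ => by
    rw [← Nat.cast_le (α := ℕ∞), coe_toNat_order (hne j)]
    exact order_le _ (hF j)
  have hsum : ∑ j, d j ≤ ∑ j, (F j).order.toNat := by
    rw [← Nat.cast_le (α := ℕ∞), Nat.cast_sum Finset.univ fun j => (F j).order.toNat]
    simp_rw [coe_toNat_order (hne _)]
    rw [← order_prod]
    exact nat_le_order _ _ (X_pow_dvd_iff.mp hdvd)
  rw [← (Finset.sum_eq_sum_iff_of_le hle).mp (le_antisymm (Finset.sum_le_sum hle) hsum) i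
    (Finset.mem_univ i)]
  exact X_pow_order_dvd

theorem exists_monic_mul_isUnit_of_isNilpotent_maximalIdeal {A : Type*} [CommRing A]
    [IsLocalRing A] (hA : IsNilpotent (IsLocalRing.maximalIdeal A)) {F : A⟦X⟧} {d : ℕ}
    (hlt : ∀ j < d, coeff j F ∈ IsLocalRing.maximalIdeal A) (hd : IsUnit (coeff d F)) :
    ∃ (W : Polynomial A) (U : A⟦X⟧), F = W * U ∧ IsUnit U ∧ W.Monic ∧ W.natDegree = d ∧
      ∀ j < d, W.coeff j ∈ IsLocalRing.maximalIdeal A := by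
  have := IsAdicComplete.of_isNilpotent hA
  have hord : (F.map (IsLocalRing.residue A)).order = d := by
    rw [order_eq_nat]
    constructor
    · rw [coeff_map]
      exact (hd.map _).ne_zero
    · intro j hj
      rw [coeff_map]
      exact Ideal.Quotient.eq_zero_iff_mem.mpr (hlt j hj)
  have hne : F.map (IsLocalRing.residue A) ≠ 0 := by
    rintro h
    simp [h] at hord
  obtain ⟨W, U, H⟩ := exists_isWeierstrassFactorization hne
  have hdeg : W.natDegree = d := by
    rw [IsWeierstrassFactorization.natDegree_eq_toNat_order_map H, hord]
    rfl
  exact ⟨W, U, H.eq_mul, H.isUnit, H.isDistinguishedAt.monic, hdeg,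
    fun j hj => H.isDistinguishedAt.mem (hdeg ▸ hj)⟩

theorem isNilpotent_maximalIdeal_of_X_pow_sum_dvd_prod {A ι : Type*} [CommRing A]
    [IsLocalRing A] [IsNoetherianRing A] [Fintype ι] {F : ι → A⟦X⟧} {d : ι → ℕ}
    (hdvd : (X : A⟦X⟧) ^ (∑ i, d i) ∣ ∏ i, F i) (hF : ∀ i, IsUnit (coeff (d i) (F i)))
    (hmax : IsLocalRing.maximalIdeal A = Ideal.span {a | ∃ i, ∃ j < d i, a = coeff j (F i)}) :
    IsNilpotent (IsLocalRing.maximalIdeal A) := by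
  obtain ⟨N, hN⟩ := IsNoetherianRing.isNilpotent_nilradical A
  refine ⟨N, le_bot_iff.mp (le_trans (Ideal.pow_right_mono ?_ N) hN.le)⟩
  rw [nilradical_eq_sInf, le_sInf_iff]
  intro q (hq : q.IsPrime)
  rw [hmax, Ideal.span_le]
  rintro _ ⟨i, j, hj, rfl⟩
  have h := X_pow_dvd_of_X_pow_sum_dvd_prod (D := A ⧸ q)
    (F := fun i => (F i).map (Ideal.Quotient.mk q)) (d := d) ?_ ?_ i
  · rw [X_pow_dvd_iff] at h
    simpa [Ideal.Quotient.eq_zero_iff_mem] using h j hj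
  · simpa using map_dvd (map (Ideal.Quotient.mk q)) hdvd
  · intro i
    rw [coeff_map]
    exact ((hF i).map _).ne_zero

theorem exists_monic_of_X_pow_sum_dvd_prod {A ι : Type*} [CommRing A]
    [IsLocalRing A] [IsNoetherianRing A] [Fintype ι] {F : ι → A⟦X⟧} {d : ι → ℕ}
    (hdvd : (X : A⟦X⟧) ^ (∑ i, d i) ∣ ∏ i, F i) (hF : ∀ i, IsUnit (coeff (d i) (F i)))
    (hmax : IsLocalRing.maximalIdeal A = Ideal.span {a | ∃ i, ∃ j < d i, a = coeff j (F i)}) :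
    ∃ W : ι → Polynomial A, (∀ i, (W i).Monic ∧ (W i).natDegree = d i) ∧
      (X : A⟦X⟧) ^ (∑ i, d i) ∣ ∏ i, (W i : A⟦X⟧) ∧
      IsLocalRing.maximalIdeal A = Ideal.span {a | ∃ i, ∃ j < d i, a = (W i).coeff j} := by
  have hnil := isNilpotent_maximalIdeal_of_X_pow_sum_dvd_prod hdvd hF hmax
  have hlt (i : ι) : ∀ j < d i, coeff j (F i) ∈ IsLocalRing.maximalIdeal A := fun j hj =>
    hmax ▸ Ideal.subset_span ⟨i, j, hj, rfl⟩
  choose W U hWU hU hmonic hdeg hmem using fun i =>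
    exists_monic_mul_isUnit_of_isNilpotent_maximalIdeal hnil (hlt i) (hF i)
  refine ⟨W, fun i => ⟨hmonic i, hdeg i⟩, ?_, le_antisymm ?_ ?_⟩
  · have hunit : IsUnit (∏ i, U i) := IsUnit.prod_univ_iff.mpr hU
    rwa [Finset.prod_congr rfl fun i _ => hWU i, Finset.prod_mul_distrib,
      hunit.dvd_mul_right] at hdvd
  · conv_lhs => rw [hmax]
    rw [Ideal.span_le]
    rintro _ ⟨i, j, hj, rfl⟩
    rw [hWU, coeff_mul]
    refine Ideal.sum_mem _ fun p hp => Ideal.mul_mem_right _ _ (Ideal.subset_span ?_)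
    refine ⟨i, p.1, ?_, by simp⟩
    have := Finset.HasAntidiagonal.mem_antidiagonal.mp hp
    omega
  · rw [Ideal.span_le]
    rintro _ ⟨i, j, hj, rfl⟩
    exact hmem i j hj

end PowerSeries

theorem MvPolynomial.exists_surjective_of_X_pow_sum_dvd_prod {K A ι : Type*} [CommRing K]
    [CommRing A] [IsLocalRing A] [IsNoetherianRing A] [Fintype ι] (κ : K →+* A)
    (hκ : ∀ a, ∃ c, a - κ c ∈ IsLocalRing.maximalIdeal A) {F : ι → PowerSeries A} {d : ι → ℕ}
    (hdvd : (PowerSeries.X : PowerSeries A) ^ (∑ i, d i) ∣ ∏ i, F i)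
    (hF : ∀ i, IsUnit (PowerSeries.coeff (d i) (F i)))
    (hmax : IsLocalRing.maximalIdeal A =
      Ideal.span {a | ∃ i, ∃ j < d i, a = PowerSeries.coeff j (F i)}) :
    ∃ g : MvPolynomial (Σ i, Fin (d i)) K →+* A, Function.Surjective g ∧
      ∀ e < ∑ i, d i, g ((∏ i, ((∑ j : Fin (d i),
        Polynomial.C (X (⟨i, j⟩ : Σ i, Fin (d i))) * Polynomial.X ^ (j : ℕ)) +
          Polynomial.X ^ (d i))).coeff e) = 0 := by
  have hnil := PowerSeries.isNilpotent_maximalIdeal_of_X_pow_sum_dvd_prod hdvd hF hmax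
  obtain ⟨W, hW, hWdvd, hWmax⟩ := PowerSeries.exists_monic_of_X_pow_sum_dvd_prod hdvd hF hmax
  let g : MvPolynomial (Σ i, Fin (d i)) K →+* A := eval₂Hom κ fun p => (W p.1).coeff p.2
  refine ⟨g, ?_, fun e he => ?_⟩
  · refine RingHom.surjective_of_isNilpotent_span g ?_ (hWmax ▸ hnil) ?_
    · rintro _ ⟨i, j, hj, rfl⟩
      exact ⟨X ⟨i, j, hj⟩, by simp [g]⟩
    · intro a
      obtain ⟨c, hc⟩ := hκ a
      exact ⟨C c, by simpa [g, ← hWmax] using hc⟩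
  · have hmap (i : ι) : ((∑ j : Fin (d i), Polynomial.C (X (⟨i, j⟩ : Σ i, Fin (d i))) *
        Polynomial.X ^ (j : ℕ)) + Polynomial.X ^ (d i)).map g = W i := by
      conv_rhs => rw [(hW i).1.as_sum, (hW i).2, ← Fin.sum_univ_eq_sum_range
        (fun j => Polynomial.C ((W i).coeff j) * Polynomial.X ^ j)]
      simp [Polynomial.map_sum, g, add_comm]
    rw [← Polynomial.coeff_map, Polynomial.map_prod, Finset.prod_congr rfl fun i _ => hmap i,
      ← Polynomial.coeff_coe]
    have hcoe : ((∏ i, W i : Polynomial A) : PowerSeries A) = ∏ i, (W i : PowerSeries A) :=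
      map_prod Polynomial.coeToPowerSeries.ringHom _ _
    rw [hcoe]
    exact PowerSeries.X_pow_dvd_iff.mp hWdvd e he

/-- The truncated series `∑ j ≤ m, x j * t ^ j`, completed by coefficients `1` from degree `m + 1`
on. -/
noncomputable def jetSeries {A : Type*} [CommRing A] {m : ℕ} (x : Fin (m + 1) → A) :
    PowerSeries A :=
  PowerSeries.mk fun j => if h : j < m + 1 then x ⟨j, h⟩ else 1

theorem coeff_jetSeries {A : Type*} [CommRing A] {m : ℕ} (x : Fin (m + 1) → A) {j : ℕ}
    (hj : j < m + 1) : PowerSeries.coeff j (jetSeries x) = x ⟨j, hj⟩ := by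
  rw [jetSeries, PowerSeries.coeff_mk, dif_pos hj]

theorem X_pow_dvd_jetSeries_sub {A : Type*} [CommRing A] {m : ℕ} (x : Fin (m + 1) → A) :
    (PowerSeries.X : PowerSeries A) ^ (m + 1) ∣ jetSeries x -
      ((∑ j, Polynomial.C (x j) * Polynomial.X ^ (j : ℕ) : Polynomial A) : PowerSeries A) := by
  rw [PowerSeries.X_pow_dvd_iff]
  intro e he
  rw [map_sub, coeff_jetSeries x he, Polynomial.coeff_coe, Polynomial.finsetSum_coeff,
    Finset.sum_eq_single ⟨e, he⟩]
  · simp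
  · intro j _ hj
    rw [Polynomial.coeff_C_mul_X_pow, if_neg]
    rintro rfl
    exact hj rfl
  · simp

theorem X_pow_dvd_prod_jetSeries_iff {A ι : Type*} [CommRing A] [Fintype ι] {m : ℕ}
    (x : ι → Fin (m + 1) → A) :
    (PowerSeries.X : PowerSeries A) ^ (m + 1) ∣ ∏ i, jetSeries (x i) ↔
      ∀ e ≤ m, (∏ i, ∑ j, Polynomial.C (x i j) * Polynomial.X ^ (j : ℕ)).coeff e = 0 := by
  have hcongr : (PowerSeries.X : PowerSeries A) ^ (m + 1) ∣ ∏ i, jetSeries (x i) -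
      ((∏ i, ∑ j, Polynomial.C (x i j) * Polynomial.X ^ (j : ℕ) : Polynomial A) :
        PowerSeries A) := by
    have hcoe := map_prod (Polynomial.coeToPowerSeries.ringHom (R := A))
      (fun i => ∑ j, Polynomial.C (x i j) * Polynomial.X ^ (j : ℕ)) Finset.univ
    simp only [Polynomial.coeToPowerSeries.ringHom_apply] at hcoe
    rw [hcoe, ← Ideal.mem_span_singleton, ← Ideal.Quotient.eq, map_prod, map_prod]
    refine Finset.prod_congr rfl fun i _ => ?_
    rw [Ideal.Quotient.eq, Ideal.mem_span_singleton]
    exact X_pow_dvd_jetSeries_sub (x i)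
  rw [(dvd_iff_dvd_of_dvd_sub hcongr), PowerSeries.X_pow_dvd_iff]
  simp [Polynomial.coeff_coe]

theorem MvPolynomial.sub_rename_killCompl_mem_span {R σ τ : Type*} [CommRing R] {f : σ → τ}
    (hf : Function.Injective f) (p : MvPolynomial τ R) :
    p - rename f (killCompl hf p) ∈ Ideal.span (X '' (Set.range f)ᶜ) := by
  rw [← Ideal.Quotient.eq]
  suffices h : (Ideal.Quotient.mkₐ R (Ideal.span (X '' (Set.range f)ᶜ))) =
      (Ideal.Quotient.mkₐ R _).comp ((rename f).comp (killCompl hf)) from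
    DFunLike.congr_fun h p
  ext t
  by_cases ht : t ∈ Set.range f
  · obtain ⟨s, rfl⟩ := ht
    have : killCompl hf (X (f s) : MvPolynomial τ R) = X s := by
      rw [← rename_X, killCompl_rename_app]
    simp [this]
  · have hX : killCompl hf (X t : MvPolynomial τ R) = 0 := by
      simp [killCompl, ht]
    simp only [AlgHom.comp_apply, hX, map_zero]
    exact Ideal.Quotient.eq_zero_iff_mem.mpr (Ideal.subset_span ⟨t, ht, rfl⟩)

theorem MvPolynomial.ker_killCompl {R σ τ : Type*} [CommRing R] {f : σ → τ}
    (hf : Function.Injective f) :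
    RingHom.ker (killCompl hf : MvPolynomial τ R →ₐ[R] MvPolynomial σ R) =
      Ideal.span (X '' (Set.range f)ᶜ) := by
  apply le_antisymm
  · intro p hp
    have := sub_rename_killCompl_mem_span hf p
    rwa [(RingHom.mem_ker).mp hp, map_zero, sub_zero] at this
  · rw [Ideal.span_le]
    rintro _ ⟨t, ht, rfl⟩
    have ht' : t ∉ Set.range f := ht
    change killCompl hf (X t) = 0
    simp [killCompl, ht']

/-- With `R_m = k[x_i^{(j)} : 1 ≤ i ≤ n, 0 ≤ j ≤ m]`,
`J_m(x_1⋯x_n)` the jet ideal, `𝔭_λ` the prime generated by the `x_i^{(j)}` with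
`j < λ_i` (`∑ λ_i = m + 1`), and `K_λ` the fraction field of the polynomial ring over
`k` in the remaining variables, let `C_λ(K_λ)` be the quotient of
`K_λ[y_{i,j} : 1 ≤ i ≤ n, 0 ≤ j ≤ λ_i-1]` (variables indexed by
`Σ i : Fin n, Fin (λ i)`) by the ideal generated by the coefficients of
`t^0,…,t^m` in `∏_i (y_{i,0} + ⋯ + y_{i,λ_i-1} t^{λ_i-1} + t^{λ_i})`.
Then there is a surjective ring homomorphism from `C_λ(K_λ)` onto the localization
`(R_m/J_m(x_1⋯x_n))_{𝔭_λ}`. -/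
theorem C_surjects_onto_jet_localization
    (k : Type*) [Field k] [CharZero k] (n m : ℕ) (hn : 0 < n) (hm : 0 < m)
    (lam : Fin n → ℕ) (hlam : ∑ i, lam i = m + 1)
    (P : Polynomial (MvPolynomial (Fin n × Fin (m + 1)) k))
    (hP : P = ∏ i : Fin n, ∑ j : Fin (m + 1),
      Polynomial.C (X (i, j)) * Polynomial.X ^ (j : ℕ))
    (J : Ideal (MvPolynomial (Fin n × Fin (m + 1)) k))
    (hJ : J = Ideal.span {q | ∃ d ≤ m, q = P.coeff d})
    (𝔭 : Ideal (MvPolynomial (Fin n × Fin (m + 1)) k))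
    (h𝔭 : 𝔭 = Ideal.span
      {q | ∃ (i : Fin n) (j : Fin (m + 1)), (j : ℕ) < lam i ∧ q = X (i, j)})
    (Q : Polynomial (MvPolynomial (Σ i : Fin n, Fin (lam i))
      (FractionRing (MvPolynomial {x : Fin n × Fin (m + 1) // lam x.1 ≤ (x.2 : ℕ)} k))))
    (hQ : Q = ∏ i : Fin n,
      ((∑ j : Fin (lam i), Polynomial.C (X (⟨i, j⟩ : Σ i : Fin n, Fin (lam i))) *
          Polynomial.X ^ (j : ℕ)) + Polynomial.X ^ (lam i)))
    (IC : Ideal (MvPolynomial (Σ i : Fin n, Fin (lam i))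
      (FractionRing (MvPolynomial {x : Fin n × Fin (m + 1) // lam x.1 ≤ (x.2 : ℕ)} k))))
    (hIC : IC = Ideal.span {q | ∃ d ≤ m, q = Q.coeff d}) :
    ∃ hp : (𝔭.map (Ideal.Quotient.mk J)).IsPrime,
      ∃ f : (MvPolynomial (Σ i : Fin n, Fin (lam i))
          (FractionRing (MvPolynomial {x : Fin n × Fin (m + 1) // lam x.1 ≤ (x.2 : ℕ)} k)) ⧸ IC) →+*
        Localization (@Ideal.primeCompl _ _ (𝔭.map (Ideal.Quotient.mk J)) hp),
        Function.Surjective f := by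
  let rest := {x : Fin n × Fin (m + 1) // lam x.1 ≤ (x.2 : ℕ)}
  have hinj : Function.Injective (Subtype.val : rest → Fin n × Fin (m + 1)) :=
    Subtype.val_injective
  have h𝔭X : 𝔭 = Ideal.span (X '' (Set.range (Subtype.val : rest → Fin n × Fin (m + 1)))ᶜ) := by
    rw [h𝔭]
    congr 1
    ext q
    simp [eq_comm]
  have h𝔭ker : 𝔭 = RingHom.ker (killCompl hinj : _ →ₐ[k] MvPolynomial rest k) := by
    rw [h𝔭X, ker_killCompl]
  have hprime : 𝔭.IsPrime := h𝔭ker ▸ RingHom.ker_isPrime _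
  have hPmap {A : Type _} [CommRing A] (φ : MvPolynomial (Fin n × Fin (m + 1)) k →+* A) :
      (PowerSeries.X : PowerSeries A) ^ (m + 1) ∣ ∏ i, jetSeries (fun j => φ (X (i, j))) ↔
        ∀ e ≤ m, φ (P.coeff e) = 0 := by
    rw [X_pow_dvd_prod_jetSeries_iff]
    simp [hP, ← Polynomial.coeff_map, Polynomial.map_prod, Polynomial.map_sum]
  have hJ𝔭 : J ≤ 𝔭 := by
    rw [hJ, Ideal.span_le]
    rintro _ ⟨e, he, rfl⟩
    refine Ideal.Quotient.eq_zero_iff_mem.mp ((hPmap (Ideal.Quotient.mk 𝔭)).mp ?_ e he)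
    refine (pow_dvd_pow _ hlam.ge).trans ?_
    rw [← Finset.prod_pow_eq_pow_sum]
    refine Finset.prod_dvd_prod_of_dvd _ _ fun i _ => ?_
    rw [PowerSeries.X_pow_dvd_iff]
    intro j hj
    have hjm : j < m + 1 := hj.trans_le
      (hlam ▸ Finset.single_le_sum (fun _ _ => Nat.zero_le _) (Finset.mem_univ i))
    rw [coeff_jetSeries _ hjm, Ideal.Quotient.eq_zero_iff_mem, h𝔭]
    exact Ideal.subset_span ⟨i, ⟨j, hjm⟩, hj, rfl⟩
  have hp : (𝔭.map (Ideal.Quotient.mk J)).IsPrime :=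
    Ideal.map_isPrime_of_surjective Ideal.Quotient.mk_surjective (by simpa using hJ𝔭)
  refine ⟨hp, ?_⟩
  suffices h : ∀ (A : Type _) [CommRing A] [Algebra (MvPolynomial (Fin n × Fin (m + 1)) k ⧸ J) A]
      [IsLocalization.AtPrime A (𝔭.map (Ideal.Quotient.mk J))],
      ∃ f : (MvPolynomial (Σ i : Fin n, Fin (lam i)) (FractionRing (MvPolynomial rest k)) ⧸ IC) →+*
        A, Function.Surjective f from h (Localization.AtPrime (𝔭.map (Ideal.Quotient.mk J)))
  intro A _ _ _
  have : IsLocalRing A := IsLocalization.AtPrime.isLocalRing A (𝔭.map (Ideal.Quotient.mk J))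
  have : IsNoetherianRing A :=
    IsLocalization.isNoetherianRing (𝔭.map (Ideal.Quotient.mk J)).primeCompl A inferInstance
  let φ : MvPolynomial (Fin n × Fin (m + 1)) k →+* A :=
    (algebraMap (MvPolynomial (Fin n × Fin (m + 1)) k ⧸ J) A).comp (Ideal.Quotient.mk J)
  have hmap : IsLocalRing.maximalIdeal A = 𝔭.map φ := by
    rw [← Ideal.map_map,
      IsLocalization.AtPrime.map_eq_maximalIdeal (𝔭.map (Ideal.Quotient.mk J)) A]
  have hunit {q} (hq : q ∉ 𝔭) : IsUnit (φ q) := by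
    refine IsLocalization.map_units A (⟨Ideal.Quotient.mk J q, fun h => hq ?_⟩ :
      (𝔭.map (Ideal.Quotient.mk J)).primeCompl)
    exact (Ideal.mem_quotient_iff_mem hJ𝔭).mp h
  have hrest : ∀ q : nonZeroDivisors (MvPolynomial rest k),
      IsUnit ((φ.comp (rename Subtype.val :
        MvPolynomial rest k →ₐ[k] MvPolynomial (Fin n × Fin (m + 1)) k).toRingHom) q) := by
    intro q
    refine hunit fun h => nonZeroDivisors.ne_zero q.2 ?_
    rw [h𝔭ker] at h
    exact (killCompl_rename_app hinj _).symm.trans h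
  let κ : FractionRing (MvPolynomial rest k) →+* A := IsLocalization.lift hrest
  have hκ_map (q) : φ q - κ (algebraMap _ _ (killCompl hinj q)) ∈ IsLocalRing.maximalIdeal A := by
    rw [IsLocalization.lift_eq, hmap]
    change φ q - φ (rename Subtype.val (killCompl hinj q)) ∈ _
    rw [← map_sub]
    exact Ideal.mem_map_of_mem φ (h𝔭X ▸ sub_rename_killCompl_mem_span hinj q)
  have hκ (a : A) : ∃ c, a - κ c ∈ IsLocalRing.maximalIdeal A := by
    obtain ⟨r', ⟨s', hs'⟩, rfl⟩ := IsLocalization.exists_mk'_eq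
      (𝔭.map (Ideal.Quotient.mk J)).primeCompl a
    obtain ⟨r, rfl⟩ := Ideal.Quotient.mk_surjective r'
    obtain ⟨s, rfl⟩ := Ideal.Quotient.mk_surjective s'
    refine ⟨algebraMap _ _ (killCompl hinj r) / algebraMap _ _ (killCompl hinj s), ?_⟩
    have hs : killCompl hinj s ≠ 0 := fun h => hs' <| Ideal.mem_map_of_mem _ <| by
      rw [h𝔭ker]
      exact h
    have hφs := hunit (q := s) fun h => hs' (Ideal.mem_map_of_mem _ h)
    have hspec : φ s * IsLocalization.mk' A (Ideal.Quotient.mk J r) ⟨Ideal.Quotient.mk J s, hs'⟩ =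
        φ r := IsLocalization.mk'_spec' A (Ideal.Quotient.mk J r) (⟨Ideal.Quotient.mk J s, hs'⟩ :
          (𝔭.map (Ideal.Quotient.mk J)).primeCompl)
    rw [← Ideal.unit_mul_mem_iff_mem _ hφs, mul_sub, hspec]
    set c : FractionRing (MvPolynomial rest k) :=
      algebraMap _ _ (killCompl hinj r) / algebraMap _ _ (killCompl hinj s) with hc
    have hκc : κ (algebraMap _ _ (killCompl hinj s)) * κ c =
        κ (algebraMap _ _ (killCompl hinj r)) := by
      rw [← map_mul, hc, mul_div_cancel₀]
      simpa using hs
    have hsplit : φ r - φ s * κ c = (φ r - κ (algebraMap _ _ (killCompl hinj r))) -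
        (φ s - κ (algebraMap _ _ (killCompl hinj s))) * κ c := by
      rw [← hκc]
      ring
    rw [hsplit]
    exact sub_mem (hκ_map r) (Ideal.mul_mem_right _ _ (hκ_map s))
  have hdvd := (hPmap φ).mpr fun e he => by
    have : P.coeff e ∈ J := hJ ▸ Ideal.subset_span ⟨e, he, rfl⟩
    simp [φ, Ideal.Quotient.eq_zero_iff_mem.mpr this]
  have hF (i : Fin n) : IsUnit (PowerSeries.coeff (lam i) (jetSeries fun j => φ (X (i, j)))) := by
    rw [jetSeries, PowerSeries.coeff_mk]
    split_ifs with h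
    · refine hunit fun hX => ?_
      rw [h𝔭ker] at hX
      have hX0 := (killCompl_rename_app hinj (X ⟨(i, ⟨lam i, h⟩), le_rfl⟩)).symm.trans
        ((congrArg _ (rename_X _ _)).trans hX)
      exact X_ne_zero _ hX0
    · exact isUnit_one
  have hmax : IsLocalRing.maximalIdeal A = Ideal.span {a | ∃ i, ∃ j < lam i,
      a = PowerSeries.coeff j (jetSeries fun j => φ (X (i, j)))} := by
    rw [hmap, h𝔭, Ideal.map_span]
    congr 1
    ext a
    constructor
    · rintro ⟨_, ⟨i, j, hj, rfl⟩, rfl⟩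
      exact ⟨i, j, hj, (coeff_jetSeries (fun j => φ (X (i, j))) j.2).symm⟩
    · rintro ⟨i, j, hj, rfl⟩
      have hjm : j < m + 1 := hj.trans_le
        (hlam ▸ Finset.single_le_sum (fun _ _ => Nat.zero_le _) (Finset.mem_univ i))
      exact ⟨_, ⟨i, ⟨j, hjm⟩, hj, rfl⟩, (coeff_jetSeries (fun j => φ (X (i, j))) hjm).symm⟩
  obtain ⟨g, hg, hg0⟩ := exists_surjective_of_X_pow_sum_dvd_prod κ hκ
    ((pow_dvd_pow _ hlam.le).trans hdvd) hF hmax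
  have hIC0 : ∀ q ∈ IC, g q = 0 := by
    suffices h : IC ≤ RingHom.ker g from h
    rw [hIC, Ideal.span_le]
    rintro _ ⟨e, he, rfl⟩
    rw [hQ]
    exact hg0 e (by omega)
  exact ⟨Ideal.Quotient.lift IC g hIC0, Ideal.Quotient.lift_surjective_of_surjective IC hIC0 hg⟩
end

section
/- Let h_1,…,h_n ∈ ℤ_{≥0} with H = h_1+⋯+h_n ≥ 1. Then the monomial y_1^{(h_1)}·y_2^{(h_2)}⋯y_n^{(h_n)} does not belong to the radical of the ideal I_{H−1}. -/
open MvPolynomial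

/-- The substitution of a family of polynomials for the differential indeterminates, with
`y_i^{(j)}` sent to the `j`-th derivative of the `i`-th polynomial, commutes with derivation. -/
theorem MvPolynomial.aeval_iterate_derivative_mkDerivation {R σ : Type*} [CommRing R]
    (f : σ → Polynomial R) (p : MvPolynomial (σ × ℕ) R) :
    aeval (fun q : σ × ℕ => Polynomial.derivative^[q.2] (f q.1))
        (mkDerivation R (fun q : σ × ℕ => (X (q.1, q.2 + 1) : MvPolynomial (σ × ℕ) R)) p) =
      Polynomial.derivative
        (aeval (fun q : σ × ℕ => Polynomial.derivative^[q.2] (f q.1)) p) := by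
  induction p using MvPolynomial.induction_on with
  | C a => simp
  | add p q hp hq => simp only [map_add, hp, hq]
  | mul_X p q hp =>
    simp only [Derivation.leibniz, map_add, smul_eq_mul, map_mul, hp, mkDerivation_X, aeval_X,
      Polynomial.derivative_mul, Function.iterate_succ_apply']
    ring

/-- In `K{y_1,…,y_n} = K[y_i^{(j)}]` (variables indexed by
`Fin n × ℕ`) with the derivation `D` determined by `D(y_i^{(j)}) = y_i^{(j+1)}`, and
`I_h` the ideal generated by `D^k(y_1⋯y_n)` for `0 ≤ k ≤ h`:  if `H = h_1 + ⋯ + h_n ≥ 1`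
then the monomial `y_1^{(h_1)} ⋯ y_n^{(h_n)}` does not belong to the radical of
`I_{H-1}`. -/
theorem monomial_not_mem_radical_jet_ideal
    (K : Type*) [Field K] [CharZero K] (n : ℕ) (hn : 0 < n) (h : Fin n → ℕ)
    (hH : 1 ≤ ∑ i, h i)
    (D : Derivation K (MvPolynomial (Fin n × ℕ) K) (MvPolynomial (Fin n × ℕ) K))
    (hD : D = MvPolynomial.mkDerivation K (fun p : Fin n × ℕ => X (p.1, p.2 + 1))) :
    ∏ i, (X (i, h i) : MvPolynomial (Fin n × ℕ) K) ∉
      (Ideal.span {q : MvPolynomial (Fin n × ℕ) K |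
        ∃ k ≤ (∑ i, h i) - 1, q = (⇑D)^[k] (∏ i, X (i, 0))}).radical := by
  subst hD
  set ψ : MvPolynomial (Fin n × ℕ) K →ₐ[K] Polynomial K :=
    aeval (fun q : Fin n × ℕ => Polynomial.derivative^[q.2] (Polynomial.X ^ h q.1)) with hψ
  have hcomm : Function.Semiconj ψ
      (mkDerivation K (fun p : Fin n × ℕ => (X (p.1, p.2 + 1) : MvPolynomial (Fin n × ℕ) K)))
      Polynomial.derivative :=
    aeval_iterate_derivative_mkDerivation fun i => Polynomial.X ^ h i
  let φ : MvPolynomial (Fin n × ℕ) K →+* K := (Polynomial.evalRingHom 0).comp ψ.toRingHom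
  have hφ (p) : φ p = (ψ p).eval 0 := rfl
  have hle : Ideal.span {q : MvPolynomial (Fin n × ℕ) K |
      ∃ k ≤ (∑ i, h i) - 1, q = (mkDerivation K (fun p : Fin n × ℕ =>
        (X (p.1, p.2 + 1) : MvPolynomial (Fin n × ℕ) K)))^[k] (∏ i, X (i, 0))} ≤
      RingHom.ker φ := by
    rw [Ideal.span_le]
    rintro _ ⟨k, hk, rfl⟩
    have hprod : ψ (∏ i, X (i, 0)) = Polynomial.X ^ ∑ i, h i := by
      simp [hψ, Finset.prod_pow_eq_pow_sum]
    have hne : (∑ i, h i) - k ≠ 0 := by omega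
    rw [SetLike.mem_coe, RingHom.mem_ker, hφ, (hcomm.iterate_right k).eq, hprod,
      Polynomial.iterate_derivative_X_pow_eq_smul]
    simp [hne]
  intro hmem
  have hker := (RingHom.ker_isPrime φ).isRadical.radical_le_iff.mpr hle hmem
  rw [RingHom.mem_ker, map_prod, Finset.prod_eq_zero_iff] at hker
  obtain ⟨i, -, hi⟩ := hker
  rw [hφ, hψ, aeval_X, Polynomial.iterate_derivative_X_pow_eq_smul] at hi
  simp [Nat.descFactorial_self, Nat.factorial_ne_zero] at hi
end
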